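/- Suppose (A1)-(A3) hold, set Λ = Λ(M), and let x_n ∈ ℤ_+^{Λ,d} be a sequence with |x_n| → ∞ and x_n/|x_n| → M/|M|. Then for every x̂ ∈ ℤ_+^{Λ,d} and every ε > 0 there exist N > 0, δ > 0 and C > 0 such that for all n ≥ N and all x ∈ ℤ_+^{Λ,d} with |x| ≤ δ|x_n|, one has G_Λ(x, x_n)/G_Λ(x̂, x_n) ≤ C exp(ε|x|). -/

import Mathlib

open Filter Topology

attribute [local instance] Classical.propDecidable

noncomputable section

variable {V : Type*} [AddCommGroup V]

/-- `n`-step transition kernel of the random walk with step distribution `μ`,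
killed upon leaving the set `A` : `kern μ A n x y = P_x(S n = y, τ_A > n)`,
where `τ_A` is the first exit time from `A`. -/
def kern (μ : V → ℝ) (A : Set V) : ℕ → V → V → ℝ
  | 0 => fun x y => if x = y ∧ x ∈ A then 1 else 0
  | n + 1 => fun x y => ∑' z : V, (if x ∈ A then μ (z - x) else 0) * kern μ A n z y

/-- Green function of the walk killed outside `A`. -/
def green (μ : V → ℝ) (A : Set V) (x y : V) : ℝ :=
  ∑' n : ℕ, kern μ A n x y

/-- `E_x [ g(S τ) ; S τ ∈ B, τ < ∞ ]`, where `τ` is the first exit time from `A`. -/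
def exitExp (μ : V → ℝ) (A B : Set V) (g : V → ℝ) (x : V) : ℝ :=
  ∑' n : ℕ, ∑' z : V, kern μ A n x z *
    ∑' y : V, (if y ∉ A ∧ y ∈ B then μ (y - z) else 0) * g y

/-- `ℝ≥0∞`-valued version of `exitExp`. -/
def exitExpE (μ : V → ℝ) (A B : Set V) (g : V → ℝ) (x : V) : ENNReal :=
  ∑' n : ℕ, ∑' z : V, ENNReal.ofReal (kern μ A n x z) *
    ∑' y : V, ENNReal.ofReal ((if y ∉ A ∧ y ∈ B then μ (y - z) else 0) * g y)

/-- `P_x(S t = y for some t ≥ 0)` for the walk killed outside `A`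
(first passage decomposition). -/
def hitProb (μ : V → ℝ) (A : Set V) (x y : V) : ℝ :=
  (if x = y ∧ x ∈ A then 1 else 0) +
    ∑' n : ℕ, ∑' z : V, kern μ (A \ {y}) n x z * (if y ∈ A then μ (y - z) else 0)

/-- `h` is (strictly speaking, satisfies the mean value property of a) harmonic
function on `A` for the walk with step distribution `μ` killed outside `A`. -/
def HarmOn (μ : V → ℝ) (A : Set V) (h : V → ℝ) : Prop :=
  ∀ x ∈ A, h x = ∑' y : V, if y ∈ A then μ (y - x) * h y else 0

/-- Irreducibility of the walk killed outside `A`. -/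
def Irred (μ : V → ℝ) (A : Set V) : Prop :=
  ∀ x ∈ A, ∀ x' ∈ A, ∃ (k : ℕ) (c : ℕ → V), c 0 = x ∧ c k = x' ∧
    (∀ j ≤ k, c j ∈ A) ∧ ∀ j < k, 0 < μ (c (j + 1) - c j)

/-- A sequence `xs` is fundamental for the walk killed outside `A` :
the Martin kernels `G(x, xs n)/G(x₀, xs n)` converge for every `x ∈ A`. -/
def Fundamental (μ : V → ℝ) (A : Set V) (x₀ : V) (xs : ℕ → V) : Prop :=
  ∀ x ∈ A, ∃ L : ℝ,
    Tendsto (fun n => green μ A x (xs n) / green μ A x₀ (xs n)) atTop (𝓝 L)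

/-- ℓ¹-norm of an integer vector. -/
def znorm {ι : Type*} [Fintype ι] (x : ι → ℤ) : ℝ := ∑ i, |(x i : ℝ)|

/-- ℓ¹-norm of a real vector. -/
def rnorm {ι : Type*} [Fintype ι] (q : ι → ℝ) : ℝ := ∑ i, |q i|

variable {d : ℕ}

/-- `ℤ^{Λ,d}_+ = {x ∈ ℤ^d : xⁱ > 0 for all i ∈ Λ}`. -/
def posDom (Λ : Set (Fin d)) : Set (Fin d → ℤ) := {x | ∀ i ∈ Λ, 0 < x i}

/-- `ℤ^d_+ = {x ∈ ℤ^d : xⁱ > 0 for all i}`. -/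
def posAll : Set (Fin d → ℤ) := {x | ∀ i, 0 < x i}

/-- `a · z` for `a ∈ ℝ^d`, `z ∈ ℤ^d`. -/
def dotZ (a : Fin d → ℝ) (z : Fin d → ℤ) : ℝ := ∑ i, a i * (z i : ℝ)

/-- `a · q` for `a, q ∈ ℝ^d`. -/
def dotR (a q : Fin d → ℝ) : ℝ := ∑ i, a i * q i

/-- jump generating function `φ(a) = Σ_z μ(z) exp(a·z)` (valued in `ℝ≥0∞`). -/
def phiE (μ : (Fin d → ℤ) → ℝ) (a : Fin d → ℝ) : ENNReal :=
  ∑' z : Fin d → ℤ, ENNReal.ofReal (μ z * Real.exp (dotZ a z))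

/-- `D = {a ∈ ℝ^d : φ(a) ≤ 1}`. -/
def Dset (μ : (Fin d → ℤ) → ℝ) : Set (Fin d → ℝ) := {a | phiE μ a ≤ 1}

/-- mean vector `M = Σ_z μ(z) z`. -/
def Mvec (μ : (Fin d → ℤ) → ℝ) : Fin d → ℝ := fun i => ∑' z : Fin d → ℤ, μ z * (z i : ℝ)

/-- `Λ(M) = {i : Mⁱ = 0}`. -/
def LambdaM (μ : (Fin d → ℤ) → ℝ) : Set (Fin d) := {i | Mvec μ i = 0}

/-- Assumption (A1) : irreducibility on every `ℤ^{Λ,d}_+`. -/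
def A1 (μ : (Fin d → ℤ) → ℝ) : Prop := ∀ Λ : Set (Fin d), Irred μ (posDom Λ)

/-- Assumption (A2) : `φ` is finite on a neighborhood of the set `D`. -/
def A2 (μ : (Fin d → ℤ) → ℝ) : Prop :=
  ∃ U : Set (Fin d → ℝ), IsOpen U ∧ Dset μ ⊆ U ∧ ∀ a ∈ U, phiE μ a ≠ ⊤

/-- Assumption (A3) : `M ≠ 0`. -/
def A3 (μ : (Fin d → ℤ) → ℝ) : Prop := Mvec μ ≠ 0

/-- projection `x ↦ x^Λ`. -/
def projL (Λ : Set (Fin d)) (x : Fin d → ℤ) : ↥Λ → ℤ := fun i => x (i : Fin d)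

/-- jump distribution `μ_Λ(v) = Σ_{x : x^Λ = v} μ(x)` of the projected walk. -/
def muL (μ : (Fin d → ℤ) → ℝ) (Λ : Set (Fin d)) (v : ↥Λ → ℤ) : ℝ :=
  ∑' x : Fin d → ℤ, if projL Λ x = v then μ x else 0

/-- `ℤ^Λ_+`. -/
def posL (Λ : Set (Fin d)) : Set (↥Λ → ℤ) := {u | ∀ i, 0 < u i}

end

section KilledWalk

variable {d : ℕ} {μ : (Fin d → ℤ) → ℝ} {A : Set (Fin d → ℤ)}

lemma hasSum_translate (hsum : HasSum μ 1) (x : Fin d → ℤ) : HasSum (fun z => μ (z - x)) 1 :=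
  (Equiv.subRight x).hasSum_iff.mpr hsum

lemma kern_mem_Icc (hnn : ∀ z, 0 ≤ μ z) (hsum : HasSum μ 1) (n : ℕ) (x y : Fin d → ℤ) :
    0 ≤ kern μ A n x y ∧ kern μ A n x y ≤ 1 := by
  induction n generalizing x with
  | zero => unfold kern; split_ifs <;> norm_num
  | succ n ih =>
    have hb : ∀ z, 0 ≤ (if x ∈ A then μ (z - x) else 0) * kern μ A n z y ∧
        (if x ∈ A then μ (z - x) else 0) * kern μ A n z y ≤ μ (z - x) := by
      intro z
      have h1 := ih z
      have h2 := hnn (z - x)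
      split_ifs
      · exact ⟨mul_nonneg h2 h1.1, mul_le_of_le_one_right h2 h1.2⟩
      · simpa using h2
    have hs := hasSum_translate hsum x
    have hs' := Summable.of_nonneg_of_le (fun z => (hb z).1) (fun z => (hb z).2) hs.summable
    refine ⟨tsum_nonneg fun z => (hb z).1, ?_⟩
    rw [← hs.tsum_eq]
    exact hs'.tsum_le_tsum (fun z => (hb z).2) hs.summable

/-- The killed kernel with values in `ℝ≥0∞`. -/
noncomputable def ekern (μ : (Fin d → ℤ) → ℝ) (A : Set (Fin d → ℤ)) (n : ℕ)
    (x y : Fin d → ℤ) : ENNReal :=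
  ENNReal.ofReal (kern μ A n x y)

/-- The Green function with values in `ℝ≥0∞`. -/
noncomputable def egreen (μ : (Fin d → ℤ) → ℝ) (A : Set (Fin d → ℤ)) (x y : Fin d → ℤ) :
    ENNReal :=
  ∑' n, ekern μ A n x y

/-- The `ℝ≥0∞`-valued step distribution. -/
noncomputable def emass (μ : (Fin d → ℤ) → ℝ) (z : Fin d → ℤ) : ENNReal := ENNReal.ofReal (μ z)

lemma tsum_emass (hnn : ∀ z, 0 ≤ μ z) (hsum : HasSum μ 1) : ∑' z, emass μ z = 1 := by
  unfold emass
  rw [← ENNReal.ofReal_tsum_of_nonneg hnn hsum.summable, hsum.tsum_eq, ENNReal.ofReal_one]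

lemma ekern_zero (x y : Fin d → ℤ) :
    ekern μ A 0 x y = if x = y ∧ x ∈ A then 1 else 0 := by
  unfold ekern kern; split_ifs <;> simp

lemma ekern_of_notMem (n : ℕ) {x : Fin d → ℤ} (hx : x ∉ A) (y : Fin d → ℤ) :
    ekern μ A n x y = 0 := by
  cases n <;> simp [ekern, kern, hx]

lemma ekern_succ (hnn : ∀ z, 0 ≤ μ z) (hsum : HasSum μ 1) (n : ℕ) {x : Fin d → ℤ} (hx : x ∈ A)
    (y : Fin d → ℤ) :
    ekern μ A (n + 1) x y = ∑' z, emass μ z * ekern μ A n (x + z) y := by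
  have h0 : ∀ z, 0 ≤ μ (z - x) * kern μ A n z y :=
    fun z => mul_nonneg (hnn _) (kern_mem_Icc hnn hsum n z y).1
  have hs : Summable fun z => μ (z - x) * kern μ A n z y :=
    Summable.of_nonneg_of_le h0
      (fun z => mul_le_of_le_one_right (hnn _) (kern_mem_Icc hnn hsum n z y).2)
      (hasSum_translate hsum x).summable
  have h1 : ekern μ A (n + 1) x y = ∑' z, ENNReal.ofReal (μ (z - x) * kern μ A n z y) := by
    rw [← ENNReal.ofReal_tsum_of_nonneg h0 hs]
    simp [ekern, kern, hx]
  rw [h1, ← (Equiv.addLeft x).tsum_eq]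
  refine tsum_congr fun z => ?_
  simp only [Equiv.coe_addLeft, add_sub_cancel_left, emass, ekern]
  exact ENNReal.ofReal_mul (hnn z)

lemma ekern_le_one (hnn : ∀ z, 0 ≤ μ z) (hsum : HasSum μ 1) (n : ℕ) (x y : Fin d → ℤ) :
    ekern μ A n x y ≤ 1 :=
  ENNReal.ofReal_le_one.mpr (kern_mem_Icc hnn hsum n x y).2

lemma tsum_ekern_le_one (hnn : ∀ z, 0 ≤ μ z) (hsum : HasSum μ 1) (n : ℕ) (x : Fin d → ℤ) :
    ∑' y, ekern μ A n x y ≤ 1 := by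
  induction n generalizing x with
  | zero =>
    simp_rw [ekern_zero]
    rw [tsum_eq_single x (fun y hy => by simp [hy.symm])]
    split_ifs <;> simp
  | succ n ih =>
    by_cases hx : x ∈ A
    · simp_rw [ekern_succ hnn hsum n hx]
      rw [ENNReal.tsum_comm, ← tsum_emass hnn hsum]
      refine ENNReal.tsum_le_tsum fun z => ?_
      rw [ENNReal.tsum_mul_left]
      exact mul_le_of_le_one_right' (ih _)
    · simp [ekern_of_notMem _ hx]

lemma ekern_add (hnn : ∀ z, 0 ≤ μ z) (hsum : HasSum μ 1) (k n : ℕ) (x y : Fin d → ℤ) :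
    ekern μ A (k + n) x y = ∑' z, ekern μ A k x z * ekern μ A n z y := by
  by_cases hx : x ∈ A
  swap
  · simp [ekern_of_notMem _ hx]
  induction k generalizing x with
  | zero =>
    simp_rw [ekern_zero]
    rw [tsum_eq_single x (fun y hy => by simp [hy.symm])]
    simp [hx]
  | succ k ih =>
    rw [Nat.add_right_comm, ekern_succ hnn hsum _ hx]
    simp_rw [ekern_succ hnn hsum _ hx, ← ENNReal.tsum_mul_right]
    rw [ENNReal.tsum_comm]
    refine tsum_congr fun z => ?_
    simp_rw [mul_assoc, ENNReal.tsum_mul_left]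
    by_cases hz : x + z ∈ A
    · rw [ih _ hz]
    · simp [ekern_of_notMem _ hz]

lemma ekern_mul_ekern_le (hnn : ∀ z, 0 ≤ μ z) (hsum : HasSum μ 1) (k n : ℕ)
    (x z y : Fin d → ℤ) :
    ekern μ A k x z * ekern μ A n z y ≤ ekern μ A (k + n) x y := by
  rw [ekern_add hnn hsum]
  exact ENNReal.le_tsum (f := fun z => ekern μ A k x z * ekern μ A n z y) z

lemma ekern_mul_egreen_le (hnn : ∀ z, 0 ≤ μ z) (hsum : HasSum μ 1) (k : ℕ)
    (x z y : Fin d → ℤ) :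
    ekern μ A k x z * egreen μ A z y ≤ egreen μ A x y := by
  unfold egreen
  rw [← ENNReal.tsum_mul_left]
  calc ∑' n, ekern μ A k x z * ekern μ A n z y ≤ ∑' n, ekern μ A (k + n) x y :=
        ENNReal.tsum_le_tsum fun n => ekern_mul_ekern_le hnn hsum k n x z y
    _ ≤ ∑' n, ekern μ A n x y :=
        ENNReal.tsum_comp_le_tsum_of_injective (add_right_injective k) _

lemma one_le_egreen_self {y : Fin d → ℤ} (hy : y ∈ A) : 1 ≤ egreen μ A y y := by
  refine le_trans ?_ (ENNReal.le_tsum 0)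
  simp [ekern_zero, hy]

lemma tsum_emass_mul_egreen_le (hnn : ∀ z, 0 ≤ μ z) (hsum : HasSum μ 1) {x : Fin d → ℤ}
    (hx : x ∈ A) (y : Fin d → ℤ) :
    ∑' z, emass μ z * egreen μ A (x + z) y ≤ egreen μ A x y := by
  unfold egreen
  simp_rw [← ENNReal.tsum_mul_left]
  rw [ENNReal.tsum_comm]
  simp_rw [← ekern_succ hnn hsum _ hx]
  exact ENNReal.tsum_comp_le_tsum_of_injective (add_left_injective 1) _

lemma toReal_egreen (hnn : ∀ z, 0 ≤ μ z) (hsum : HasSum μ 1) (x y : Fin d → ℤ) :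
    green μ A x y = (egreen μ A x y).toReal := by
  unfold green egreen
  rw [ENNReal.tsum_toReal_eq (f := fun n => ekern μ A n x y) (fun n => ENNReal.ofReal_ne_top)]
  exact tsum_congr fun n => (ENNReal.toReal_ofReal (kern_mem_Icc hnn hsum n x y).1).symm

lemma prod_emass_le_ekern (hnn : ∀ z, 0 ≤ μ z) (hsum : HasSum μ 1) (k : ℕ)
    (c : ℕ → Fin d → ℤ) (hc : ∀ j ≤ k, c j ∈ A) :
    ∏ j ∈ Finset.range k, emass μ (c (j + 1) - c j) ≤ ekern μ A k (c 0) (c k) := by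
  induction k generalizing c with
  | zero => simp [ekern_zero, hc 0 le_rfl]
  | succ k ih =>
    rw [Finset.prod_range_succ', ekern_succ hnn hsum _ (hc 0 (Nat.zero_le _)), mul_comm]
    refine le_trans ?_ (ENNReal.le_tsum (c 1 - c 0))
    rw [add_sub_cancel]
    gcongr
    exact ih (fun j => c (j + 1)) fun j hj => hc _ (by lia)

lemma ekern_le_translate (hnn : ∀ z, 0 ≤ μ z) (hsum : HasSum μ 1) (n : ℕ) {w : Fin d → ℤ}
    (hw : ∀ x ∈ A, x + w ∈ A) (x y : Fin d → ℤ) :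
    ekern μ A n x y ≤ ekern μ A n (x + w) (y + w) := by
  by_cases hx : x ∈ A
  swap
  · simp [ekern_of_notMem _ hx]
  induction n generalizing x with
  | zero => simp only [ekern_zero, add_left_inj]; split_ifs <;> grind
  | succ n ih =>
    rw [ekern_succ hnn hsum _ hx, ekern_succ hnn hsum _ (hw x hx)]
    gcongr with z
    rw [add_right_comm]
    by_cases hz : x + z ∈ A
    · exact ih _ hz
    · simp [ekern_of_notMem _ hz]

/-- Iterates of the kernel `K` applied to `u`, where each of the `m` steps may use the distinguished
transition `x ↦ x + w` of weight `p`, and where `h` weighs the number of its uses. -/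
noncomputable def countIter (K : (Fin d → ℤ) → (Fin d → ℤ) → ENNReal) (A : Set (Fin d → ℤ))
    (w : Fin d → ℤ) (p : ENNReal) (u : (Fin d → ℤ) → ENNReal) :
    ℕ → (ℕ → ENNReal) → (Fin d → ℤ) → ENNReal
  | 0, h => fun x => h 0 * u x
  | m + 1, h => fun x =>
      (if x ∈ A then p * countIter K A w p u m (fun j => h (j + 1)) (x + w) else 0)
      + ∑' z, (K x z - if x ∈ A ∧ z = x + w then p else 0) * countIter K A w p u m h z

section Counting

variable {K : (Fin d → ℤ) → (Fin d → ℤ) → ENNReal} {w : Fin d → ℤ} {p : ENNReal}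
  {u : (Fin d → ℤ) → ENNReal}

lemma split_kernel (hK : ∀ x ∈ A, p ≤ K x (x + w)) (g : (Fin d → ℤ) → ENNReal)
    (x : Fin d → ℤ) :
    (if x ∈ A then p * g (x + w) else 0)
      + ∑' z, (K x z - if x ∈ A ∧ z = x + w then p else 0) * g z = ∑' z, K x z * g z := by
  have h1 : (if x ∈ A then p * g (x + w) else 0)
      = ∑' z, (if x ∈ A ∧ z = x + w then p else 0) * g z := by
    rw [tsum_eq_single (x + w) (fun z hz => by simp [hz])]
    split_ifs <;> simp_all
  rw [h1, ← ENNReal.tsum_add]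
  refine tsum_congr fun z => ?_
  rw [← add_mul, add_tsub_cancel_of_le]
  split_ifs with h
  · rw [h.2]; exact hK x h.1
  · exact zero_le

lemma countIter_add (m : ℕ) (h₁ h₂ : ℕ → ENNReal) (x : Fin d → ℤ) :
    countIter K A w p u m (fun j => h₁ j + h₂ j) x
      = countIter K A w p u m h₁ x + countIter K A w p u m h₂ x := by
  induction m generalizing h₁ h₂ x with
  | zero => simp [countIter, add_mul]
  | succ m ih =>
    simp only [countIter, ih, mul_add, ENNReal.tsum_add]
    split_ifs <;> ring

lemma countIter_const_mul (m : ℕ) (c : ENNReal) (h : ℕ → ENNReal) (x : Fin d → ℤ) :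
    countIter K A w p u m (fun j => c * h j) x = c * countIter K A w p u m h x := by
  induction m generalizing h x with
  | zero => simp [countIter, mul_assoc]
  | succ m ih =>
    simp only [countIter, ih, mul_add, mul_left_comm _ c, ENNReal.tsum_mul_left]
    split_ifs <;> simp

lemma countIter_mono (m : ℕ) {h₁ h₂ : ℕ → ENNReal} (hh : ∀ j, h₁ j ≤ h₂ j) (x : Fin d → ℤ) :
    countIter K A w p u m h₁ x ≤ countIter K A w p u m h₂ x := by
  induction m generalizing h₁ h₂ x with
  | zero => simp only [countIter]; gcongr; exact hh 0
  | succ m ih =>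
    simp only [countIter]
    refine add_le_add ?_ (ENNReal.tsum_le_tsum fun z => ?_)
    · split_ifs
      · gcongr; exact ih (fun j => hh (j + 1)) _
      · exact le_rfl
    · gcongr; exact ih hh _

lemma countIter_one_succ (hK : ∀ x ∈ A, p ≤ K x (x + w)) (m : ℕ) (x : Fin d → ℤ) :
    countIter K A w p u (m + 1) (fun _ => 1) x
      = ∑' z, K x z * countIter K A w p u m (fun _ => 1) z := by
  rw [← split_kernel hK]; rfl

/-- Deleting one use of the distinguished transition. -/
lemma countIter_id_le (hK : ∀ x ∈ A, p ≤ K x (x + w)) (hKw : ∀ x z, K x z ≤ K (x + w) (z + w))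
    (m : ℕ) (x : Fin d → ℤ) :
    countIter K A w p u (m + 1) (fun j => (j : ENNReal)) x
      ≤ (m + 1 : ℕ) * p * countIter K A w p u m (fun _ => 1) (x + w) := by
  have key : ∀ m x, countIter K A w p u (m + 1) (fun j => (j : ENNReal)) x
      ≤ p * countIter K A w p u m (fun _ => 1) (x + w)
        + ∑' z, K x z * countIter K A w p u m (fun j => (j : ENNReal)) z := by
    intro m x
    rw [← split_kernel hK]
    simp only [countIter, Nat.cast_add, Nat.cast_one, countIter_add]
    rw [← add_assoc]
    refine add_le_add ?_ le_rfl
    split_ifs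
    · rw [mul_add, add_comm]
    · exact zero_le
  induction m generalizing x with
  | zero =>
    refine (key 0 x).trans ?_
    simp [countIter]
  | succ m ih =>
    refine (key (m + 1) x).trans ?_
    have h2 : ∑' z, K x z * countIter K A w p u (m + 1) (fun j => (j : ENNReal)) z
        ≤ (m + 1 : ℕ) * p * countIter K A w p u (m + 1) (fun _ => 1) (x + w) := by
      rw [countIter_one_succ hK, ← (Equiv.addRight w).tsum_eq
        (fun z => K (x + w) z * countIter K A w p u m (fun _ => 1) z), ← ENNReal.tsum_mul_left]
      refine ENNReal.tsum_le_tsum fun z => ?_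
      calc K x z * countIter K A w p u (m + 1) (fun j => (j : ENNReal)) z
          ≤ K (x + w) (z + w) *
            ((m + 1 : ℕ) * p * countIter K A w p u m (fun _ => 1) (z + w)) := by
            gcongr
            · exact hKw x z
            · exact ih z
        _ = _ := by simp only [Equiv.coe_addRight]; ring
    calc _ ≤ p * countIter K A w p u (m + 1) (fun _ => 1) (x + w)
          + (m + 1 : ℕ) * p * countIter K A w p u (m + 1) (fun _ => 1) (x + w) := by gcongr
      _ = _ := by push_cast; ring

lemma countIter_pow_le (hK : ∀ x ∈ A, p ≤ K x (x + w)) (hK1 : ∀ x, ∑' z, K x z ≤ 1)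
    (hK0 : ∀ x ∉ A, ∀ z, K x z = 0)
    (hu : ∀ x, u x ≤ 1) (t : ENNReal) (m : ℕ) (x : Fin d → ℤ) :
    countIter K A w p u m (fun j => t ^ j) x ≤ (p * t + (1 - p)) ^ m := by
  induction m generalizing x with
  | zero => simpa [countIter] using hu x
  | succ m ih =>
    by_cases hx : x ∈ A
    swap
    · simp [countIter, hx, hK0 x hx]
    have hp : p ≠ ⊤ := ne_top_of_le_ne_top ENNReal.one_ne_top
      ((hK x hx).trans ((ENNReal.le_tsum _).trans (hK1 x)))
    have hR : ∑' z, (K x z - if x ∈ A ∧ z = x + w then p else 0) ≤ 1 - p := by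
      have h := split_kernel hK (fun _ => 1) x
      simp only [hx, if_true, mul_one] at h
      refine ENNReal.le_sub_of_add_le_left hp ?_
      simp only [hx]
      exact h.trans_le (hK1 x)
    simp only [countIter, hx, if_true, pow_succ', countIter_const_mul]
    calc _ ≤ p * (t * (p * t + (1 - p)) ^ m) + ∑' z, (K x z -
          if x ∈ A ∧ z = x + w then p else 0) * (p * t + (1 - p)) ^ m := by
          simp only [hx]
          gcongr
          · exact ih _
          · exact ih _
      _ ≤ p * (t * (p * t + (1 - p)) ^ m) + (1 - p) * (p * t + (1 - p)) ^ m := by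
          rw [ENNReal.tsum_mul_right]; gcongr
      _ = _ := by ring

lemma mul_countIter_le (hK : ∀ x ∈ A, p ≤ K x (x + w)) (hKw : ∀ x z, K x z ≤ K (x + w) (z + w))
    (hK1 : ∀ x, ∑' z, K x z ≤ 1) (hK0 : ∀ x ∉ A, ∀ z, K x z = 0) (hu : ∀ x, u x ≤ 1)
    (s a : ℝ) (hs : 0 ≤ s) (ha : 0 ≤ a) (m : ℕ) (x : Fin d → ℤ) :
    ENNReal.ofReal a * countIter K A w p u (m + 1) (fun _ => 1) x
      ≤ (m + 1 : ℕ) * p * countIter K A w p u m (fun _ => 1) (x + w)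
        + ENNReal.ofReal (a * Real.exp (s * a)) *
          (p * ENNReal.ofReal (Real.exp (-s)) + (1 - p)) ^ (m + 1) := by
  have hj : ∀ j : ℕ, ENNReal.ofReal a * 1 ≤ (j : ENNReal)
      + ENNReal.ofReal (a * Real.exp (s * a)) * ENNReal.ofReal (Real.exp (-s)) ^ j := by
    intro j
    rw [mul_one, ← ENNReal.ofReal_natCast, ← ENNReal.ofReal_pow (Real.exp_nonneg _),
      ← ENNReal.ofReal_mul (by positivity), ← ENNReal.ofReal_add (by positivity) (by positivity)]
    refine ENNReal.ofReal_le_ofReal ?_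
    rw [← Real.exp_nat_mul, mul_assoc, ← Real.exp_add]
    rcases le_total a j with h | h
    · have : 0 ≤ a * Real.exp (s * a + j * -s) := by positivity
      linarith
    · have h1 : 1 ≤ Real.exp (s * a + j * -s) := Real.one_le_exp (by nlinarith)
      have : (0 : ℝ) ≤ j := by positivity
      nlinarith
  rw [← countIter_const_mul]
  refine (countIter_mono _ hj x).trans ?_
  rw [countIter_add, countIter_const_mul]
  gcongr
  · exact countIter_id_le hK hKw m x
  · exact countIter_pow_le hK hK1 hK0 hu _ _ x

end Counting

lemma countIter_one_eq_ekern (hnn : ∀ z, 0 ≤ μ z) (hsum : HasSum μ 1) {k : ℕ} {w : Fin d → ℤ}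
    {p : ENNReal} (hp : ∀ x ∈ A, p ≤ ekern μ A k x (x + w)) (r : ℕ) (y : Fin d → ℤ) (m : ℕ)
    (x : Fin d → ℤ) :
    countIter (ekern μ A k) A w p (fun z => ekern μ A r z y) m (fun _ => 1) x
      = ekern μ A (k * m + r) x y := by
  induction m generalizing x with
  | zero => simp [countIter]
  | succ m ih =>
    rw [countIter_one_succ hp]
    simp_rw [ih]
    rw [← ekern_add hnn hsum]
    congr 1; ring

lemma ekern_shift_compare (hnn : ∀ z, 0 ≤ μ z) (hsum : HasSum μ 1) {w : Fin d → ℤ}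
    (hw : ∀ x ∈ A, x + w ∈ A) {k : ℕ} (hk : 0 < k) {p : ℝ} (hp0 : 0 < p) (hp1 : p ≤ 1)
    (hp : ∀ x ∈ A, ENNReal.ofReal p ≤ ekern μ A k x (x + w)) {ε : ℝ} (hε : 0 < ε) (hε1 : ε < 1) :
    ∃ α c₀ : ℝ, 0 < α ∧ ∀ (n : ℕ) (x y : Fin d → ℤ),
      ENNReal.ofReal (1 - ε) * ekern μ A n x y
        ≤ (if k ≤ n then ekern μ A (n - k) (x + w) y else 0)
          + ENNReal.ofReal (Real.exp (c₀ - α * n)) := by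
  have hβ : 0 < p * (1 - Real.exp (-ε) - ε * (1 - ε)) := by
    refine mul_pos hp0 ?_
    have h1 : Real.exp (-ε) * Real.exp ε = 1 := by rw [← Real.exp_add]; simp
    have h2 := Real.add_one_le_exp ε
    have h3 := Real.exp_pos (-ε)
    have h4 : Real.exp (-ε) * (1 + ε) ≤ 1 := by nlinarith
    nlinarith [mul_pos hε hε, mul_pos (mul_pos hε hε) hε]
  set β := p * (1 - Real.exp (-ε) - ε * (1 - ε)) with hβdef
  have hk' : (0 : ℝ) < k := by exact_mod_cast hk
  refine ⟨β / k, β, div_pos hβ hk', fun n x y => ?_⟩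
  rcases lt_or_ge n k with hn | hn
  · rw [if_neg (not_le.mpr hn), zero_add]
    refine le_trans (mul_le_one' (ENNReal.ofReal_le_one.mpr (by linarith))
      (ekern_le_one hnn hsum n x y)) ?_
    rw [ENNReal.one_le_ofReal]
    refine Real.one_le_exp ?_
    have : (n : ℝ) ≤ k := by exact_mod_cast hn.le
    have h2 : β / k * n ≤ β / k * k := by gcongr
    rw [div_mul_cancel₀ _ hk'.ne'] at h2
    linarith
  rw [if_pos hn]
  obtain ⟨m, hm⟩ : ∃ m, n / k = m + 1 := ⟨n / k - 1, by have := Nat.div_pos hn hk; lia⟩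
  set r := n % k with hr
  have hrk : r < k := Nat.mod_lt _ hk
  have hnr : n = k * (m + 1) + r := by rw [← hm]; exact (Nat.div_add_mod n k).symm
  have hnk : n - k = k * m + r := by rw [hnr]; lia
  have main := mul_countIter_le hp (fun x z => ekern_le_translate hnn hsum k hw x z)
    (tsum_ekern_le_one hnn hsum k) (fun x hx z => ekern_of_notMem k hx z)
    (u := fun z => ekern μ A r z y) (fun z => ekern_le_one hnn hsum r z y)
    ε ((m + 1 : ℕ) * p * (1 - ε)) hε.le
    (mul_nonneg (by positivity) (by linarith)) m x
  rw [countIter_one_eq_ekern hnn hsum hp, countIter_one_eq_ekern hnn hsum hp, ← hnr, ← hnk] at main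
  have hc : ((m + 1 : ℕ) : ENNReal) * ENNReal.ofReal p = ENNReal.ofReal ((m + 1 : ℕ) * p) := by
    rw [ENNReal.ofReal_mul (by positivity), ENNReal.ofReal_natCast]
  have hcpos : (0 : ℝ) < (m + 1 : ℕ) * p := by positivity
  rw [hc, ENNReal.ofReal_mul hcpos.le, mul_assoc (ENNReal.ofReal ((m + 1 : ℕ) * p)),
    mul_assoc ((m + 1 : ℕ) * p), ENNReal.ofReal_mul hcpos.le,
    mul_assoc (ENNReal.ofReal ((m + 1 : ℕ) * p)), ← mul_add,
    ENNReal.mul_le_mul_iff_right (by simpa using hcpos) ENNReal.ofReal_ne_top] at main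
  refine main.trans (add_le_add le_rfl ?_)
  rw [← ENNReal.ofReal_mul hp0.le, ← ENNReal.ofReal_one, ← ENNReal.ofReal_sub _ hp0.le,
    ← ENNReal.ofReal_add (by positivity) (by linarith), ← ENNReal.ofReal_pow, ← ENNReal.ofReal_mul]
  rotate_left
  · have : 0 ≤ 1 - ε := by linarith
    positivity
  · have := mul_pos hp0 (Real.exp_pos (-ε)); linarith
  refine ENNReal.ofReal_le_ofReal ?_
  have h1 : p * Real.exp (-ε) + (1 - p) ≤ Real.exp (-(p * (1 - Real.exp (-ε)))) := by
    refine le_trans (le_of_eq ?_) (Real.add_one_le_exp _); ring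
  have h0 : 0 ≤ p * Real.exp (-ε) + (1 - p) := by
    have := mul_pos hp0 (Real.exp_pos (-ε)); linarith
  have hn' : (n : ℝ) ≤ k * (m + 2 : ℕ) := by
    have : n ≤ k * (m + 2) := by rw [hnr]; nlinarith
    exact_mod_cast this
  have hn2 : β / k * n ≤ β * (m + 2 : ℕ) := by
    calc β / k * n ≤ β / k * (k * (m + 2 : ℕ)) := by gcongr
      _ = _ := by field_simp
  calc (1 - ε) * Real.exp (ε * ((m + 1 : ℕ) * p * (1 - ε))) *
        (p * Real.exp (-ε) + (1 - p)) ^ (m + 1)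
      ≤ 1 * Real.exp (ε * ((m + 1 : ℕ) * p * (1 - ε))) *
        Real.exp (-(p * (1 - Real.exp (-ε)))) ^ (m + 1) := by
        gcongr; linarith
    _ = Real.exp (-(β * (m + 1 : ℕ))) := by
        rw [one_mul, ← Real.exp_nat_mul, ← Real.exp_add]
        congr 1; rw [hβdef]; ring
    _ ≤ _ := by
        gcongr
        push_cast at hn2 ⊢
        linarith

lemma znorm_nonneg (x : Fin d → ℤ) : 0 ≤ znorm x := Finset.sum_nonneg fun _ _ => abs_nonneg _

lemma znorm_add_le (x y : Fin d → ℤ) : znorm (x + y) ≤ znorm x + znorm y := by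
  unfold znorm
  rw [← Finset.sum_add_distrib]
  refine Finset.sum_le_sum fun i _ => ?_
  simpa using abs_add_le (x i : ℝ) (y i)

lemma znorm_neg (x : Fin d → ℤ) : znorm (-x) = znorm x := by
  simp [znorm]

lemma znorm_sub_le (x y : Fin d → ℤ) : znorm (x - y) ≤ znorm x + znorm y := by
  rw [sub_eq_add_neg, ← znorm_neg y]; exact znorm_add_le x (-y)

lemma ekern_le_exp (hnn : ∀ z, 0 ≤ μ z) (hsum : HasSum μ 1) {s b : ℝ} (hs : 0 ≤ s)
    (hm : ∑' z, emass μ z * ENNReal.ofReal (Real.exp (s * znorm z)) ≤ ENNReal.ofReal (Real.exp b))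
    (n : ℕ) (x y : Fin d → ℤ) :
    ekern μ A n x y ≤ ENNReal.ofReal (Real.exp (b * n - s * znorm (y - x))) := by
  induction n generalizing x with
  | zero =>
    rw [ekern_zero]
    split_ifs with h
    · simp [h.1, znorm]
    · exact zero_le
  | succ n ih =>
    by_cases hx : x ∈ A
    swap
    · simp [ekern_of_notMem _ hx]
    rw [ekern_succ hnn hsum _ hx]
    calc ∑' z, emass μ z * ekern μ A n (x + z) y
        ≤ ∑' z, (emass μ z * ENNReal.ofReal (Real.exp (s * znorm z))) *
            ENNReal.ofReal (Real.exp (b * n - s * znorm (y - x))) := by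
          refine ENNReal.tsum_le_tsum fun z => ?_
          rw [mul_assoc]
          gcongr
          refine (ih _).trans ?_
          rw [← ENNReal.ofReal_mul (Real.exp_nonneg _), ← Real.exp_add]
          refine ENNReal.ofReal_le_ofReal (Real.exp_le_exp.mpr ?_)
          have : znorm (y - x) ≤ znorm (y - (x + z)) + znorm z := by
            refine le_trans (le_of_eq ?_) (znorm_add_le _ _); congr 1; abel
          nlinarith
      _ ≤ ENNReal.ofReal (Real.exp b) * ENNReal.ofReal (Real.exp (b * n - s * znorm (y - x))) := by
          rw [ENNReal.tsum_mul_right]; gcongr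
      _ = _ := by
          rw [← ENNReal.ofReal_mul (Real.exp_nonneg _), ← Real.exp_add]
          congr 2; push_cast; ring

lemma egreen_shift_compare (hnn : ∀ z, 0 ≤ μ z) (hsum : HasSum μ 1) {s b : ℝ} (hs : 0 < s)
    (hb : 0 ≤ b)
    (hm : ∑' z, emass μ z * ENNReal.ofReal (Real.exp (s * znorm z)) ≤ ENNReal.ofReal (Real.exp b))
    {w : Fin d → ℤ} (hw : ∀ x ∈ A, x + w ∈ A) {k : ℕ} (hk : 0 < k) {p : ℝ} (hp0 : 0 < p)
    (hp1 : p ≤ 1) (hp : ∀ x ∈ A, ENNReal.ofReal p ≤ ekern μ A k x (x + w)) {ε : ℝ} (hε : 0 < ε)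
    (hε1 : ε < 1) :
    ∃ c C : ℝ, 0 < c ∧ 0 < C ∧ ∀ x y : Fin d → ℤ,
      ENNReal.ofReal (1 - ε) * egreen μ A x y
        ≤ egreen μ A (x + w) y + ENNReal.ofReal (C * Real.exp (-(c * znorm (y - x)))) := by
  obtain ⟨α, c₀, hα, H⟩ := ekern_shift_compare hnn hsum hw hk hp0 hp1 hp hε hε1
  set l := α / (2 * (α + b)) with hl
  have hab : 0 < α + b := by linarith
  have hl0 : 0 < l := by positivity
  have hl1 : l ≤ 1 := by rw [hl, div_le_one (by positivity)]; linarith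
  have hlα : l * (α + b) = α / 2 := by rw [hl]; field_simp
  have hs1 : Summable fun n : ℕ => Real.exp (-(α / 2) * n) := by
    simpa [mul_comm] using Real.summable_exp_nat_mul_iff.mpr (show -(α / 2) < 0 by linarith)
  refine ⟨l * s, Real.exp ((1 - l) * c₀) * ∑' n : ℕ, Real.exp (-(α / 2) * n), by positivity,
    mul_pos (Real.exp_pos _) (hs1.tsum_pos (fun _ => Real.exp_nonneg _) 0 (Real.exp_pos _)),
    fun x y => ?_⟩
  have hstep : ∀ n : ℕ, ENNReal.ofReal (1 - ε) * ekern μ A n x y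
      ≤ (if k ≤ n then ekern μ A (n - k) (x + w) y else 0)
        + ENNReal.ofReal (Real.exp ((1 - l) * c₀) * Real.exp (-(l * s * znorm (y - x)))
          * Real.exp (-(α / 2) * n)) := by
    intro n
    rw [← Real.exp_add, ← Real.exp_add]
    have hconv : (1 - l) * c₀ + -(l * s * znorm (y - x)) + -(α / 2) * n
        = (1 - l) * (c₀ - α * n) + l * (b * n - s * znorm (y - x)) := by
      linear_combination (-(n : ℝ)) * hlα
    rw [hconv]
    rcases le_total (c₀ - α * n) (b * n - s * znorm (y - x)) with h | h
    · refine (H n x y).trans (add_le_add le_rfl ?_)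
      refine ENNReal.ofReal_le_ofReal (Real.exp_le_exp.mpr ?_)
      nlinarith
    · refine le_add_left ?_
      refine (mul_le_of_le_one_left' (ENNReal.ofReal_le_one.mpr (by linarith))).trans ?_
      refine (ekern_le_exp hnn hsum hs.le hm n x y).trans ?_
      refine ENNReal.ofReal_le_ofReal (Real.exp_le_exp.mpr ?_)
      nlinarith
  unfold egreen
  rw [← ENNReal.tsum_mul_left]
  refine (ENNReal.tsum_le_tsum hstep).trans ?_
  rw [ENNReal.tsum_add]
  refine add_le_add ?_ (le_of_eq ?_)
  · rw [← ENNReal.summable.sum_add_tsum_nat_add' (k := k), Finset.sum_eq_zero, zero_add]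
    · simp
    · intro i hi; rw [if_neg]; simpa using hi
  · rw [← ENNReal.ofReal_tsum_of_nonneg (fun n => by positivity) (hs1.mul_left _), tsum_mul_left]
    congr 1; ring

/-- The unit vectors `± eᵢ`. -/
def unitSteps (d : ℕ) : Set (Fin d → ℤ) :=
  Set.range fun q : Fin d × Bool => Pi.single q.1 (if q.2 then 1 else -1)

lemma finite_unitSteps : (unitSteps d).Finite := Set.finite_range _

lemma znorm_unitSteps {w : Fin d → ℤ} (hw : w ∈ unitSteps d) : znorm w = 1 := by
  obtain ⟨⟨i, σ⟩, rfl⟩ := hw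
  unfold znorm
  rw [Finset.sum_eq_single i (fun j _ hj => by simp [hj]) (by simp)]
  cases σ <;> simp

lemma exists_unitStep {x x' : Fin d → ℤ} (h : x ≠ x') :
    ∃ w ∈ unitSteps d, znorm (x' - x) = znorm (x' - (x + w)) + 1 ∧
      ∀ i, min (x i) (x' i) ≤ (x + w) i ∧ (x + w) i ≤ max (x i) (x' i) := by
  obtain ⟨i, hi⟩ := Function.ne_iff.mp h
  refine ⟨_, ⟨(i, decide (x i < x' i)), rfl⟩, ?_, fun j => ?_⟩
  · unfold znorm
    generalize hw : (fun q : Fin d × Bool => (Pi.single q.1 (if q.2 then 1 else -1) : Fin d → ℤ))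
      (i, decide (x i < x' i)) = w
    rw [← Finset.add_sum_erase Finset.univ (fun j => |(((x' - x) j : ℤ) : ℝ)|) (Finset.mem_univ i),
      ← Finset.add_sum_erase Finset.univ (fun j => |(((x' - (x + w)) j : ℤ) : ℝ)|)
        (Finset.mem_univ i), add_right_comm]
    subst hw
    congr 1
    · norm_cast
      by_cases h1 : x i < x' i
      · simp only [h1, Pi.sub_apply, Pi.add_apply, Pi.single_eq_same, decide_true, if_true]
        grind
      · simp only [h1, Pi.sub_apply, Pi.add_apply, Pi.single_eq_same, decide_false]
        grind
    · refine Finset.sum_congr rfl fun j hj => ?_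
      simp [Finset.ne_of_mem_erase hj]
  · by_cases hj : j = i
    · subst hj
      by_cases h1 : x j < x' j
      · simp [h1]
      · simp [h1]
        grind
    · simp [hj]

lemma znorm_eq_natCast (x : Fin d → ℤ) : znorm x = (∑ i, (x i).natAbs : ℕ) := by
  simp [znorm, Nat.cast_natAbs]

/-- Chaining an inequality between neighbours along a monotone lattice path to `x'`. -/
lemma le_of_unitSteps (f : (Fin d → ℤ) → ENNReal) (K : ℝ) (S : Set (Fin d → ℤ))
    (x' : Fin d → ℤ)
    (hS : ∀ x ∈ S, ∀ w ∈ unitSteps d,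
      (∀ i, min (x i) (x' i) ≤ (x + w) i ∧ (x + w) i ≤ max (x i) (x' i)) →
      x + w ∈ S ∧ f x ≤ ENNReal.ofReal (Real.exp K) * f (x + w))
    {x : Fin d → ℤ} (hx : x ∈ S) :
    f x ≤ ENNReal.ofReal (Real.exp (K * znorm (x' - x))) * f x' := by
  obtain ⟨n, hn⟩ : ∃ n : ℕ, znorm (x' - x) = n := ⟨_, znorm_eq_natCast _⟩
  induction n generalizing x with
  | zero =>
    by_cases h : x = x'
    · subst h; simp [znorm]
    · obtain ⟨w, -, hw, -⟩ := exists_unitStep h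
      have := znorm_nonneg (x' - (x + w))
      rw [hn] at hw; push_cast at hw; linarith
  | succ n ih =>
    by_cases h : x = x'
    · subst h; simp [znorm] at hn; norm_cast at hn
    · obtain ⟨w, hwu, hw, hb⟩ := exists_unitStep h
      obtain ⟨h1, h2⟩ := hS x hx w hwu hb
      have hn' : znorm (x' - (x + w)) = n := by rw [hn] at hw; push_cast at hw; linarith
      refine h2.trans ?_
      calc _ ≤ ENNReal.ofReal (Real.exp K) *
            (ENNReal.ofReal (Real.exp (K * znorm (x' - (x + w)))) * f x') := by
            gcongr; exact ih h1 hn'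
        _ = _ := by
            rw [← mul_assoc, ← ENNReal.ofReal_mul (Real.exp_nonneg _), ← Real.exp_add, hw]
            congr 3; ring

variable {Λ : Set (Fin d)}

lemma exists_pattern (hnn : ∀ z, 0 ≤ μ z) (hsum : HasSum μ 1) (hirr : Irred μ (posDom Λ))
    {b w : Fin d → ℤ} (hb : b ∈ posDom Λ) (hbw : b + w ∈ posDom Λ) :
    ∃ (k : ℕ) (p : ℝ), (w ≠ 0 → 0 < k) ∧ 0 < p ∧ p ≤ 1 ∧
      ∀ x, (∀ i ∈ Λ, b i ≤ x i) → ENNReal.ofReal p ≤ ekern μ (posDom Λ) k x (x + w) := by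
  obtain ⟨k, c, h0, hk, hA, hμ⟩ := hirr b hb _ hbw
  have key : ∀ x, (∀ i ∈ Λ, b i ≤ x i) →
      ENNReal.ofReal (∏ j ∈ Finset.range k, μ (c (j + 1) - c j))
        ≤ ekern μ (posDom Λ) k x (x + w) := by
    intro x hx
    rw [ENNReal.ofReal_prod_of_nonneg (fun _ _ => hnn _)]
    have := prod_emass_le_ekern hnn hsum (A := posDom Λ) k (fun j => x - b + c j)
      (fun j hj i hi => by
        have h1 := hA j hj i hi
        have h2 := hx i hi
        simp only [Pi.add_apply, Pi.sub_apply]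
        lia)
    have e : x - b + (b + w) = x + w := by abel
    simpa [emass, h0, hk, e] using this
  refine ⟨k, _, ?_, Finset.prod_pos fun j hj => hμ j (Finset.mem_range.mp hj), ?_, key⟩
  · rintro hw
    rcases Nat.eq_zero_or_pos k with rfl | h
    · rw [h0] at hk; simp at hk; exact absurd hk hw
    · exact h
  · rw [← ENNReal.ofReal_le_one]
    exact (key b fun i _ => le_rfl).trans (ekern_le_one hnn hsum _ _ _)

lemma exists_egreen_step (hnn : ∀ z, 0 ≤ μ z) (hsum : HasSum μ 1) (hirr : Irred μ (posDom Λ))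
    (w : Fin d → ℤ) :
    ∃ K : ℝ, ∀ x ∈ posDom Λ, x + w ∈ posDom Λ → ∀ y, egreen μ (posDom Λ) x y
      ≤ ENNReal.ofReal (Real.exp K) * egreen μ (posDom Λ) (x + w) y := by
  obtain ⟨k, p, -, hp0, -, hp⟩ := exists_pattern (b := fun i => max 1 (1 + w i)) (w := -w)
    hnn hsum hirr (fun i _ => by simp) (fun i _ => by simp only [Pi.add_apply, Pi.neg_apply]; grind)
  refine ⟨-Real.log p, fun x hx hxw y => ?_⟩
  have h1 := hp (x + w) (fun i hi => by
    have := hx i hi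
    have := hxw i hi
    simp only [Pi.add_apply] at *
    grind)
  have h2 := ekern_mul_egreen_le (A := posDom Λ) hnn hsum k (x + w) (x + w + -w) y
  rw [add_neg_cancel_right] at h1 h2
  rw [Real.exp_neg, Real.exp_log hp0, ENNReal.ofReal_inv_of_pos hp0, mul_comm, ← div_eq_mul_inv,
    ENNReal.le_div_iff_mul_le (by simp [hp0]) (by simp), mul_comm]
  exact le_trans (by gcongr) h2

/-- Harnack inequality. -/
lemma exists_egreen_harnack (hnn : ∀ z, 0 ≤ μ z) (hsum : HasSum μ 1)
    (hirr : Irred μ (posDom Λ)) :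
    ∃ K : ℝ, 0 < K ∧ ∀ x ∈ posDom Λ, ∀ x' ∈ posDom Λ, ∀ y, egreen μ (posDom Λ) x y
      ≤ ENNReal.ofReal (Real.exp (K * znorm (x' - x))) * egreen μ (posDom Λ) x' y := by
  choose K hK using exists_egreen_step hnn hsum hirr
  obtain ⟨K₀, hK₀⟩ := (finite_unitSteps (d := d)).image K |>.bddAbove
  refine ⟨max K₀ 1, by positivity, fun x hx x' hx' y => ?_⟩
  refine le_of_unitSteps (fun z => egreen μ (posDom Λ) z y) _ (posDom Λ) x' ?_ hx
  intro z hz w hw hb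
  have hzw : z + w ∈ posDom Λ := fun i hi => lt_of_lt_of_le
    (lt_min (hz i hi) (hx' i hi)) (hb i).1
  refine ⟨hzw, (hK w z hz hzw y).trans ?_⟩
  gcongr
  exact (hK₀ ⟨w, hw, rfl⟩).trans (le_max_left _ _)

lemma exists_exp_moment (hsum : HasSum μ 1) (hnn : ∀ z, 0 ≤ μ z) (hA2 : A2 μ) :
    ∃ s b : ℝ, 0 < s ∧ 0 ≤ b ∧
      ∑' z, emass μ z * ENNReal.ofReal (Real.exp (s * znorm z)) ≤ ENNReal.ofReal (Real.exp b) := by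
  obtain ⟨U, hU, hDU, hfin⟩ := hA2
  have h0 : (0 : Fin d → ℝ) ∈ U := by
    refine hDU ?_
    have := tsum_emass hnn hsum
    simp only [emass] at this
    simp [Dset, phiE, dotZ, this]
  obtain ⟨r, hr, hball⟩ := Metric.isOpen_iff.mp hU 0 h0
  let a : (Fin d → Bool) → Fin d → ℝ := fun σ i => if σ i then r / 2 else -(r / 2)
  have ha : ∀ σ, phiE μ (a σ) ≠ ⊤ := by
    intro σ
    refine hfin _ (hball ?_)
    rw [Metric.mem_ball, dist_pi_lt_iff hr]
    intro i
    simp only [a, Pi.zero_apply, dist_zero_right, Real.norm_eq_abs]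
    split_ifs
    · rw [abs_of_pos (by linarith)]; linarith
    · rw [abs_neg, abs_of_pos (by linarith)]; linarith
  have hle : ∑' z, emass μ z * ENNReal.ofReal (Real.exp (r / 2 * znorm z))
      ≤ ∑ σ, phiE μ (a σ) := by
    unfold phiE
    rw [← Summable.tsum_finsetSum (fun _ _ => ENNReal.summable)]
    refine ENNReal.tsum_le_tsum fun z => ?_
    refine le_trans (le_of_eq ?_) (Finset.single_le_sum
      (f := fun σ => ENNReal.ofReal (μ z * Real.exp (dotZ (a σ) z))) (fun _ _ => zero_le)
      (Finset.mem_univ (fun i => decide (0 ≤ z i))))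
    rw [emass, ← ENNReal.ofReal_mul (hnn z)]
    congr 3
    unfold znorm dotZ
    rw [Finset.mul_sum]
    refine Finset.sum_congr rfl fun i _ => ?_
    by_cases h : 0 ≤ z i
    · have : (0 : ℝ) ≤ z i := by exact_mod_cast h
      simp [a, h, abs_of_nonneg this]
    · have : (z i : ℝ) < 0 := by exact_mod_cast not_le.mp h
      simp [a, h, abs_of_neg this]
  have hT : ∑ σ, phiE μ (a σ) ≠ ⊤ := by simpa using ha
  refine ⟨r / 2, (∑ σ, phiE μ (a σ)).toReal, by linarith, ENNReal.toReal_nonneg, hle.trans ?_⟩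
  rw [← ENNReal.ofReal_toReal hT]
  refine ENNReal.ofReal_le_ofReal ?_
  rw [ENNReal.toReal_ofReal ENNReal.toReal_nonneg]
  linarith [Real.add_one_le_exp (∑ σ, phiE μ (a σ)).toReal]

lemma summable_mul_sq (hnn : ∀ z, 0 ≤ μ z) {s b : ℝ} (hs : 0 < s)
    (hm : ∑' z, emass μ z * ENNReal.ofReal (Real.exp (s * znorm z)) ≤ ENNReal.ofReal (Real.exp b))
    (i : Fin d) : Summable fun z => μ z * (z i : ℝ) ^ 2 := by
  have h1 : Summable fun z => μ z * Real.exp (s * znorm z) := by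
    have := ENNReal.summable_toReal (ne_top_of_le_ne_top ENNReal.ofReal_ne_top hm)
    refine this.congr fun z => ?_
    rw [ENNReal.toReal_mul, emass, ENNReal.toReal_ofReal (hnn z),
      ENNReal.toReal_ofReal (Real.exp_nonneg _)]
  refine Summable.of_nonneg_of_le (fun z => mul_nonneg (hnn z) (sq_nonneg _)) (fun z => ?_)
    (h1.mul_left (2 / s ^ 2))
  have h2 : |(z i : ℝ)| ≤ znorm z :=
    Finset.single_le_sum (f := fun i => |(z i : ℝ)|) (fun _ _ => abs_nonneg _) (Finset.mem_univ i)
  have h3 := Real.quadratic_le_exp_of_nonneg (mul_nonneg hs.le (znorm_nonneg z))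
  have h4 : (z i : ℝ) ^ 2 ≤ znorm z ^ 2 := by rw [← sq_abs]; gcongr
  have h5 : (z i : ℝ) ^ 2 ≤ 2 / s ^ 2 * Real.exp (s * znorm z) := by
    rw [div_mul_eq_mul_div, le_div_iff₀ (by positivity)]
    nlinarith [mul_nonneg hs.le (znorm_nonneg z), sq_nonneg s]
  calc μ z * (z i : ℝ) ^ 2 ≤ μ z * (2 / s ^ 2 * Real.exp (s * znorm z)) := by
        gcongr; exact hnn z
    _ = _ := by ring

/-- One step of the walk with step weights `m`, acting on functions. -/
noncomputable def stepAvg (m : (Fin d → ℤ) → ENNReal) (h : (Fin d → ℤ) → ENNReal)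
    (x : Fin d → ℤ) : ENNReal :=
  ∑' z, m z * h (x + z)

lemma stepAvg_iterate_succ (m h : (Fin d → ℤ) → ENNReal) (k : ℕ) (x : Fin d → ℤ) :
    (stepAvg m)^[k + 1] h x = ∑' z, m z * (stepAvg m)^[k] h (x + z) := by
  rw [Function.iterate_succ_apply']; rfl

/-- Chebyshev's inequality for the walk with step distribution `ν`. -/
lemma one_le_stepAvg_add {ν : (Fin d → ℤ) → ℝ} (hnn : ∀ z, 0 ≤ ν z) (hsum : HasSum ν 1)
    {a q : Fin d → ℝ} (ha : ∀ i, HasSum (fun z => ν z * (z i : ℝ)) (a i))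
    (hq : ∀ i, HasSum (fun z => ν z * (z i : ℝ) ^ 2) (q i)) {Q : ℝ} (hQ : ∑ i, q i ≤ Q)
    (c : Fin d → ℝ) {r : ℝ} (hr : 0 < r) (k : ℕ) (x : Fin d → ℤ) :
    1 ≤ (stepAvg (emass ν))^[k] (fun y => if ∑ i, ((y i : ℝ) - c i) ^ 2 ≤ r then 1 else 0) x
      + ENNReal.ofReal ((∑ i, ((x i : ℝ) + k * a i - c i) ^ 2 + k * Q) / r) := by
  have hQ0 : 0 ≤ Q := le_trans (Finset.sum_nonneg fun i _ =>
    (hq i).nonneg fun z => mul_nonneg (hnn z) (sq_nonneg _)) hQ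
  induction k generalizing x with
  | zero =>
    simp only [Function.iterate_zero, id_eq, Nat.cast_zero, zero_mul, add_zero]
    split_ifs with h
    · exact le_self_add
    · rw [zero_add, ENNReal.one_le_ofReal, one_le_div hr]
      exact (not_le.mp h).le
  | succ k ih =>
    rw [stepAvg_iterate_succ]
    set β : Fin d → ℝ := fun i => (x i : ℝ) + k * a i - c i with hβ
    have h1 : HasSum (fun z : Fin d → ℤ => ν z *
          ((∑ i, ((((x + z) i : ℤ) : ℝ) + k * a i - c i) ^ 2 + k * Q) / r))
        ((∑ i, (q i + 2 * β i * a i + β i ^ 2) + k * Q) / r) := by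
      have h2 : HasSum (fun z : Fin d → ℤ =>
          ((∑ i, (ν z * (z i : ℝ) ^ 2 + 2 * β i * (ν z * (z i : ℝ)) + β i ^ 2 * ν z)
            + k * Q * ν z) / r))
          ((∑ i, (q i + 2 * β i * a i + β i ^ 2 * 1) + k * Q * 1) / r) :=
        ((hasSum_sum fun i _ => ((hq i).add ((ha i).mul_left _)).add (hsum.mul_left _)).add
          (hsum.mul_left _)).div_const r
      convert h2 using 2 with z
      · rw [mul_div_assoc', mul_add, Finset.mul_sum]
        congr 2
        · refine Finset.sum_congr rfl fun i _ => ?_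
          simp only [hβ, Pi.add_apply, Int.cast_add]; ring
        · ring
      · simp
    calc (1 : ENNReal) = ∑' z, emass ν z * 1 := by simp [tsum_emass hnn hsum]
      _ ≤ ∑' z, (emass ν z * (stepAvg (emass ν))^[k]
            (fun y => if ∑ i, ((y i : ℝ) - c i) ^ 2 ≤ r then 1 else 0) (x + z)
          + ENNReal.ofReal (ν z *
            ((∑ i, ((((x + z) i : ℤ) : ℝ) + k * a i - c i) ^ 2 + k * Q) / r))) := by
        refine ENNReal.tsum_le_tsum fun z => ?_
        rw [ENNReal.ofReal_mul (hnn z), ← emass, ← mul_add]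
        gcongr
        exact ih (x + z)
      _ ≤ _ := by
        rw [ENNReal.tsum_add]
        refine add_le_add le_rfl ?_
        rw [← ENNReal.ofReal_tsum_of_nonneg _ h1.summable, h1.tsum_eq]
        · refine ENNReal.ofReal_le_ofReal ?_
          gcongr ?_ / r
          have h3 : ∑ i, (q i + 2 * β i * a i + β i ^ 2)
              ≤ ∑ i, ((x i : ℝ) + (k + 1 : ℕ) * a i - c i) ^ 2 + ∑ i, q i := by
            rw [← Finset.sum_add_distrib]
            refine Finset.sum_le_sum fun i _ => ?_
            simp only [hβ]
            push_cast
            nlinarith [sq_nonneg (a i)]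
          push_cast at h3 ⊢
          linarith
        · intro z; have := hnn z; positivity

/-- Comparison of event probabilities for two step distributions with square integrable density. -/
lemma two_mul_stepAvg_le {ℓ : (Fin d → ℤ) → ℝ} (hnn : ∀ z, 0 ≤ μ z) (hℓ : ∀ z, 0 < ℓ z) {κ : ℝ}
    (hκ : HasSum (fun z => μ z * ℓ z ^ 2) κ) (p : (Fin d → ℤ) → Prop) (k : ℕ)
    (α : ℝ) (hα : 0 < α) (x : Fin d → ℤ) :
    2 * (stepAvg (emass fun z => μ z * ℓ z))^[k] (fun y => if p y then 1 else 0) x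
      ≤ ENNReal.ofReal (α * κ ^ k)
        + ENNReal.ofReal α⁻¹ * (stepAvg (emass μ))^[k] (fun y => if p y then 1 else 0) x := by
  have hκ0 : 0 ≤ κ := hκ.nonneg fun z => mul_nonneg (hnn z) (sq_nonneg _)
  induction k generalizing α x with
  | zero =>
    simp only [Function.iterate_zero, id_eq, pow_zero, mul_one]
    split_ifs
    · rw [mul_one, mul_one, ← ENNReal.ofReal_add hα.le (by positivity)]
      have : (2 : ℝ) ≤ α + α⁻¹ := by
        rw [← sub_nonneg]
        have : α + α⁻¹ - 2 = (α - 1) ^ 2 * α⁻¹ := by field_simp; ring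
        rw [this]; positivity
      simpa using ENNReal.ofReal_le_ofReal this
    · simp
  | succ k ih =>
    rw [stepAvg_iterate_succ, stepAvg_iterate_succ, ← ENNReal.tsum_mul_left,
      ← ENNReal.tsum_mul_left]
    have h1 : ENNReal.ofReal (α * κ ^ (k + 1))
        = ∑' z, ENNReal.ofReal (α * κ ^ k * (μ z * ℓ z ^ 2)) := by
      rw [← ENNReal.ofReal_tsum_of_nonneg _ (hκ.summable.mul_left _), (hκ.mul_left _).tsum_eq]
      · congr 1; ring
      · intro z; have := hnn z; positivity
    rw [h1, ← ENNReal.tsum_add]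
    refine ENNReal.tsum_le_tsum fun z => ?_
    rw [mul_left_comm]
    refine (mul_le_mul_right (ih (α * ℓ z) (mul_pos hα (hℓ z)) (x + z)) _).trans (le_of_eq ?_)
    have hz := hnn z
    have hl := hℓ z
    rw [mul_add, emass, emass, ← mul_assoc, ← mul_assoc (ENNReal.ofReal α⁻¹),
      ← ENNReal.ofReal_mul (by positivity), ← ENNReal.ofReal_mul (by positivity),
      ← ENNReal.ofReal_mul (by positivity),
      show μ z * ℓ z * (α * ℓ z * κ ^ k) = α * κ ^ k * (μ z * ℓ z ^ 2) by ring,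
      show μ z * ℓ z * (α * ℓ z)⁻¹ = α⁻¹ * μ z by field_simp]

lemma stepAvg_le_truncated {m h : (Fin d → ℤ) → ENNReal} (hm : ∑' z, m z ≤ 1) (hh : ∀ x, h x ≤ 1)
    (s : Finset (Fin d → ℤ)) {Δ : ENNReal} (hΔ : ∑' z, (if z ∈ s then 0 else m z) ≤ Δ) (k : ℕ)
    (x : Fin d → ℤ) :
    (stepAvg m)^[k] h x ≤ (stepAvg fun z => if z ∈ s then m z else 0)^[k] h x + k * Δ := by
  have hle : ∀ k x, (stepAvg m)^[k] h x ≤ 1 := by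
    intro k
    induction k with
    | zero => exact hh
    | succ k ih =>
      intro x
      rw [stepAvg_iterate_succ]
      refine le_trans (ENNReal.tsum_le_tsum fun z => ?_) hm
      exact mul_le_of_le_one_right' (ih _)
  induction k generalizing x with
  | zero => simp
  | succ k ih =>
    rw [stepAvg_iterate_succ, stepAvg_iterate_succ]
    calc ∑' z, m z * (stepAvg m)^[k] h (x + z)
        ≤ ∑' z, ((if z ∈ s then m z else 0) *
            (stepAvg fun z => if z ∈ s then m z else 0)^[k] h (x + z)
            + m z * (k * Δ) + (if z ∈ s then 0 else m z)) := by
          refine ENNReal.tsum_le_tsum fun z => ?_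
          split_ifs
          · rw [add_zero, ← mul_add]; gcongr; exact ih _
          · exact le_add_left (mul_le_of_le_one_right' (hle _ _))
      _ ≤ _ := by
          rw [ENNReal.tsum_add, ENNReal.tsum_add, ENNReal.tsum_mul_right, add_assoc]
          refine add_le_add le_rfl ?_
          push_cast
          rw [add_mul, one_mul]
          exact add_le_add (mul_le_of_le_one_left' hm) hΔ

lemma stepAvg_truncated_le (s : Finset (Fin d → ℤ)) {b : ℤ}
    (hb : ∀ z ∈ s, ∀ i, |z i| ≤ b) {u : (Fin d → ℤ) → ENNReal}
    (hu : ∀ x ∈ posDom Λ, ∑' z, emass μ z * u (x + z) ≤ u x) {h : (Fin d → ℤ) → ENNReal}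
    {t : ENNReal} {x : Fin d → ℤ} (ht : ∀ v, t * h v ≤ u (x + v)) (k : ℕ) (v : Fin d → ℤ)
    (hv : ∀ i ∈ Λ, k * b < (x + v) i) :
    t * (stepAvg fun z => if z ∈ s then emass μ z else 0)^[k] h v ≤ u (x + v) := by
  induction k generalizing v with
  | zero => exact ht v
  | succ k ih =>
    rw [stepAvg_iterate_succ, ← ENNReal.tsum_mul_left]
    by_cases hs : s.Nonempty
    swap
    · simp [Finset.not_nonempty_iff_eq_empty.mp hs]
    obtain ⟨z₀, hz₀⟩ := hs
    refine le_trans (ENNReal.tsum_le_tsum fun z => ?_) (hu (x + v) fun i hi => ?_)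
    · split_ifs with hz
      · rw [mul_left_comm, add_assoc]
        gcongr
        refine ih (v + z) fun i hi => ?_
        have h1 := hv i hi
        have h2 := (abs_le.mp (hb z hz i)).1
        push_cast at h1
        simp only [Pi.add_apply] at h1 ⊢
        linarith
      · simp
    · have h1 := hv i hi
      have h2 := (abs_nonneg _).trans (hb z₀ hz₀ i)
      have : 0 ≤ ((k + 1 : ℕ) : ℤ) * b := by positivity
      linarith

/-- A bounded perturbation of the step distribution pushing the walk into the orthant. -/
lemma exists_tilt (hsum : HasSum μ 1) (hirr : Irred μ (posDom Λ)) {M : Fin d → ℝ}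
    (hM : ∀ i, HasSum (fun z => μ z * (z i : ℝ)) (M i)) (hMΛ : ∀ i ∈ Λ, M i = 0) :
    ∃ (g : (Fin d → ℤ) → ℝ) (G : ℝ) (v : Fin d → ℝ), (∀ z, |g z| ≤ G) ∧
      HasSum (fun z => μ z * g z) 0 ∧ (∀ i, HasSum (fun z => μ z * g z * (z i : ℝ)) (v i)) ∧
      ∀ i ∈ Λ, v i = 1 := by
  obtain ⟨k, c, h0, hk, -, hμ⟩ := hirr (fun _ => 1) (fun _ _ => one_pos) (fun _ => 2)
    (fun _ _ => two_pos)
  let st : ℕ → Fin d → ℤ := fun j => c (j + 1) - c j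
  have hst : ∀ f : (Fin d → ℤ) → ℝ, HasSum (fun z => μ z *
      (∑ j ∈ Finset.range k, if z = st j then (μ (st j))⁻¹ else 0) * f z)
      (∑ j ∈ Finset.range k, f (st j)) := by
    intro f
    simp_rw [Finset.mul_sum, Finset.sum_mul]
    refine hasSum_sum fun j hj => ?_
    have h := hasSum_ite_eq (st j) (f (st j))
    refine h.congr_fun fun z => ?_
    split_ifs with hz
    · rw [hz, mul_inv_cancel₀ (hμ j (Finset.mem_range.mp hj)).ne', one_mul]
    · simp
  refine ⟨fun z => (∑ j ∈ Finset.range k, if z = st j then (μ (st j))⁻¹ else 0) - k,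
    ∑ j ∈ Finset.range k, |(μ (st j))⁻¹| + k, fun i => 1 - k * M i, fun z => ?_, ?_,
    fun i => ?_, fun i hi => by simp [hMΛ i hi]⟩
  · refine (abs_sub _ _).trans ?_
    rw [Nat.abs_cast]
    gcongr
    refine (Finset.abs_sum_le_sum_abs _ _).trans (Finset.sum_le_sum fun j _ => ?_)
    split_ifs <;> simp
  · have h := (hst fun _ => 1).sub (hsum.mul_right (k : ℝ))
    simp only [mul_one, Finset.sum_const, Finset.card_range, nsmul_eq_mul, one_mul, sub_self] at h
    simpa only [mul_sub] using h
  · have h := (hst fun z => (z i : ℝ)).sub ((hM i).mul_right (k : ℝ))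
    have e : ∑ j ∈ Finset.range k, ((st j i : ℤ) : ℝ) = 1 := by
      have := Finset.sum_range_sub (fun j => (c j i : ℝ)) k
      simp only [st, Pi.sub_apply, Int.cast_sub]
      rw [this, h0, hk]; norm_num
    rw [e, mul_comm] at h
    refine h.congr_fun fun z => ?_
    ring

lemma ofReal_inv_le_of_half_le {I J : ENNReal} {X : ℝ} (hX : 0 < X)
    (h1 : 1 ≤ J + ENNReal.ofReal (1 / 2))
    (h2 : 2 * J ≤ ENNReal.ofReal (1 / 2) + ENNReal.ofReal (2 * X) * I) :
    ENNReal.ofReal (4 * X)⁻¹ ≤ I := by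
  rcases eq_or_ne I ⊤ with rfl | hI
  · exact le_top
  have hJ : J ≠ ⊤ := by
    have h3 := ne_top_of_le_ne_top (ENNReal.add_ne_top.mpr ⟨ENNReal.ofReal_ne_top,
      ENNReal.mul_ne_top ENNReal.ofReal_ne_top hI⟩) h2
    rintro rfl
    simp at h3
  lift I to NNReal using hI
  lift J to NNReal using hJ
  rw [← ENNReal.ofReal_coe_nnreal, ← ENNReal.ofReal_one,
    ← ENNReal.ofReal_add (by positivity) (by positivity),
    ENNReal.ofReal_le_ofReal_iff (by positivity)] at h1
  rw [← ENNReal.ofReal_coe_nnreal, ← ENNReal.ofReal_coe_nnreal (p := I),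
    ← ENNReal.ofReal_mul (by positivity), ← ENNReal.ofReal_add (by positivity) (by positivity),
    show (2 : ENNReal) = ENNReal.ofReal 2 by simp, ← ENNReal.ofReal_mul (by positivity),
    ENNReal.ofReal_le_ofReal_iff (by positivity)] at h2
  rw [← ENNReal.ofReal_coe_nnreal]
  refine ENNReal.ofReal_le_ofReal ?_
  rw [inv_le_iff_one_le_mul₀ (by positivity)]
  nlinarith

/-- Choice of the tilting strength `e` and of the number of steps `k`. -/
lemma exists_tilt_parameters {G Q W η : ℝ} (hG0 : 0 ≤ G) (hQ0 : 0 ≤ Q) (hW0 : 0 ≤ W)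
    (hη : 0 < η) :
    ∃ (e : ℝ) (k : ℕ), 0 < e ∧ e ≤ 1 ∧ e * G ≤ 1 / 2 ∧ e * W ≤ η ∧ (0 : ℝ) < k ∧
      8 * Q ≤ k * e ^ 2 ∧ ∀ κ : ℝ, 1 ≤ κ → κ ≤ 1 + e ^ 2 * G ^ 2 →
        2 * Real.exp (-(η * (k * e / 2))) ≤ (4 * κ ^ k)⁻¹ := by
  set K : ℝ := 8 * Q + 1 with hK
  set L : ℝ := 3 + (K + 1) * G ^ 2 with hL
  have hL0 : 0 < L := by positivity
  obtain ⟨e, he0, he1, heG, heL, heW⟩ : ∃ e : ℝ, 0 < e ∧ e ≤ 1 ∧ e * G ≤ 1 / 2 ∧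
      e * (2 * L) ≤ η ∧ e * W ≤ η := by
    have hT : 0 < 1 + 2 * G + 2 * L / η + W / η := by positivity
    refine ⟨1 / (1 + 2 * G + 2 * L / η + W / η), by positivity, ?_, ?_, ?_, ?_⟩
    · rw [div_le_one hT]
      have : 0 ≤ 2 * G + 2 * L / η + W / η := by positivity
      linarith
    · rw [div_mul_eq_mul_div, div_le_iff₀ hT]
      have : 0 ≤ 2 * L / η + W / η := by positivity
      linarith
    · rw [div_mul_eq_mul_div, div_le_iff₀ hT]
      have : 0 ≤ η * (1 + 2 * G + W / η) := by positivity
      have h2 : η * (2 * L / η) = 2 * L := by field_simp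
      linarith
    · rw [div_mul_eq_mul_div, div_le_iff₀ hT]
      have : 0 ≤ η * (1 + 2 * G + 2 * L / η) := by positivity
      have h2 : η * (W / η) = W := by field_simp
      linarith
  set k : ℕ := ⌈K / e ^ 2⌉₊ with hk
  have hk1 : K ≤ k * e ^ 2 := (div_le_iff₀ (by positivity)).mp (Nat.le_ceil _)
  have hk2 : k * e ^ 2 ≤ K + 1 := by
    have h1 : (k : ℝ) < K / e ^ 2 + 1 := Nat.ceil_lt_add_one (by positivity)
    have h2 : (K / e ^ 2 + 1) * e ^ 2 = K + e ^ 2 := by field_simp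
    nlinarith
  have hk0 : (0 : ℝ) < k := by
    by_contra h
    have : (k : ℝ) = 0 := le_antisymm (not_lt.mp h) (Nat.cast_nonneg _)
    rw [this, zero_mul] at hk1
    linarith
  have hg : L ≤ η * (k * e / 2) := by
    have h1 : 1 ≤ k * e * e := by nlinarith
    have h2 : 2 * L * (k * e * e) ≤ η * (k * e) := by
      nlinarith [mul_le_mul_of_nonneg_right heL (mul_nonneg hk0.le he0.le)]
    nlinarith
  refine ⟨e, k, he0, he1, heG, heW, hk0, by linarith, fun κ hκ1 hκ2 => ?_⟩
  have hκk : κ ^ k ≤ Real.exp ((K + 1) * G ^ 2) := by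
    have h1 : κ ≤ Real.exp (e ^ 2 * G ^ 2) := by
      have h2 := Real.add_one_le_exp (e ^ 2 * G ^ 2)
      linarith
    calc κ ^ k ≤ Real.exp (e ^ 2 * G ^ 2) ^ k := pow_le_pow_left₀ (by linarith) h1 _
      _ = Real.exp (k * (e ^ 2 * G ^ 2)) := (Real.exp_nat_mul _ _).symm
      _ ≤ _ := Real.exp_le_exp.mpr (by nlinarith [mul_le_mul_of_nonneg_right hk2 (sq_nonneg G)])
  have hκk0 : 0 < κ ^ k := by positivity
  have h3 : (8 : ℝ) ≤ Real.exp 3 := by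
    have h4 := Real.exp_one_gt_d9
    have : Real.exp 3 = Real.exp 1 ^ 3 := by rw [← Real.exp_nat_mul]; norm_num
    rw [this]
    have : (2 : ℝ) ^ 3 ≤ Real.exp 1 ^ 3 := pow_le_pow_left₀ (by norm_num) (by linarith) 3
    linarith
  have h5 : 8 * κ ^ k ≤ Real.exp (η * (k * e / 2)) := by
    calc 8 * κ ^ k ≤ Real.exp 3 * Real.exp ((K + 1) * G ^ 2) := by gcongr
      _ = Real.exp L := by rw [← Real.exp_add]
      _ ≤ _ := Real.exp_le_exp.mpr hg
  rw [Real.exp_neg, ← div_eq_mul_inv, div_le_iff₀ (Real.exp_pos _), inv_mul_eq_div,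
    le_div_iff₀ (by positivity)]
  linarith

/-- With a probability that is not too small, a zero-drift set of coordinates of the walk reaches
height `g` within `k` steps while the walk stays close to its mean. -/
lemma exists_event_prob (hnn : ∀ z, 0 ≤ μ z) (hsum : HasSum μ 1) (hirr : Irred μ (posDom Λ))
    {M : Fin d → ℝ} (hM : ∀ i, HasSum (fun z => μ z * (z i : ℝ)) (M i)) (hMΛ : ∀ i ∈ Λ, M i = 0)
    (hsq : ∀ i, Summable fun z => μ z * (z i : ℝ) ^ 2) {η : ℝ} (hη : 0 < η) :
    ∃ (k : ℕ) (g : ℝ) (p : (Fin d → ℤ) → Prop), 0 < g ∧ g ≤ k ∧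
      (∀ y, p y → (∀ i ∈ Λ, g ≤ y i) ∧ ∑ i, |(y i : ℝ) - k * M i| ≤ η * k) ∧
      ENNReal.ofReal (2 * Real.exp (-(η * g)))
        ≤ (stepAvg (emass μ))^[k] (fun y => if p y then 1 else 0) 0 := by
  obtain ⟨g₀, G, v, hG, hg₀, hv, hvΛ⟩ := exists_tilt hsum hirr hM hMΛ
  have hG0 : 0 ≤ G := (abs_nonneg _).trans (hG 0)
  set Q : ℝ := ∑ i, 2 * ∑' z, μ z * (z i : ℝ) ^ 2 with hQdef
  have hQ0 : 0 ≤ Q := Finset.sum_nonneg fun i _ => mul_nonneg two_pos.le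
    (tsum_nonneg fun z => mul_nonneg (hnn z) (sq_nonneg _))
  set W : ℝ := d + ∑ i, |v i| with hW
  have hW0 : 0 ≤ W := by positivity
  obtain ⟨e, k, he0, he1, heG, heW, hk0, hkQ, h8⟩ := exists_tilt_parameters hG0 hQ0 hW0 hη
  have hℓ : ∀ z, 1 / 2 ≤ 1 + e * g₀ z ∧ 1 + e * g₀ z ≤ 2 := fun z => by
    have h1 := abs_le.mp (hG z)
    constructor <;> nlinarith
  have hν0 : ∀ z, 0 ≤ μ z * (1 + e * g₀ z) := fun z => mul_nonneg (hnn z) (by linarith [hℓ z])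
  have hν1 : HasSum (fun z => μ z * (1 + e * g₀ z)) 1 := by
    have := hsum.add (hg₀.mul_left e)
    simp only [mul_zero, add_zero] at this
    exact this.congr_fun fun z => by ring
  have hνa : ∀ i, HasSum (fun z => μ z * (1 + e * g₀ z) * (z i : ℝ)) (M i + e * v i) := fun i =>
    ((hM i).add ((hv i).mul_left e)).congr_fun fun z => by ring
  have hνle : ∀ i z, μ z * (1 + e * g₀ z) * (z i : ℝ) ^ 2 ≤ 2 * (μ z * (z i : ℝ) ^ 2) :=
    fun i z => by
      have := mul_le_mul_of_nonneg_left (hℓ z).2 (mul_nonneg (hnn z) (sq_nonneg (z i : ℝ)))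
      linarith
  have hνs : ∀ i, Summable fun z => μ z * (1 + e * g₀ z) * (z i : ℝ) ^ 2 := fun i =>
    Summable.of_nonneg_of_le (fun z => mul_nonneg (hν0 z) (sq_nonneg _)) (hνle i)
      ((hsq i).mul_left 2)
  have hνQ : ∑ i, ∑' z, μ z * (1 + e * g₀ z) * (z i : ℝ) ^ 2 ≤ Q :=
    Finset.sum_le_sum fun i _ => by
      rw [← tsum_mul_left]
      exact (hνs i).tsum_le_tsum (hνle i) ((hsq i).mul_left 2)
  have hgle : ∀ z, μ z * g₀ z ^ 2 ≤ μ z * G ^ 2 := fun z =>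
    mul_le_mul_of_nonneg_left (sq_le_sq' (abs_le.mp (hG z)).1 (abs_le.mp (hG z)).2) (hnn z)
  have hgs : Summable fun z => μ z * g₀ z ^ 2 :=
    Summable.of_nonneg_of_le (fun z => mul_nonneg (hnn z) (sq_nonneg _)) hgle
      (hsum.summable.mul_right _)
  set κ : ℝ := 1 + e ^ 2 * ∑' z, μ z * g₀ z ^ 2 with hκdef
  have hκ : HasSum (fun z => μ z * (1 + e * g₀ z) ^ 2) κ := by
    have := (hsum.add (hg₀.mul_left (2 * e))).add (hgs.hasSum.mul_left (e ^ 2))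
    simp only [mul_zero, add_zero] at this
    exact this.congr_fun fun z => by ring
  have hS0 : 0 ≤ ∑' z, μ z * g₀ z ^ 2 := tsum_nonneg fun z => mul_nonneg (hnn z) (sq_nonneg _)
  have hSG : ∑' z, μ z * g₀ z ^ 2 ≤ G ^ 2 := by
    have := hgs.tsum_le_tsum hgle (hsum.summable.mul_right _)
    rwa [(hsum.mul_right _).tsum_eq, one_mul] at this
  have hκ1 : 1 ≤ κ := le_add_of_nonneg_right (by positivity)
  have hκk0 : 0 < κ ^ k := by positivity
  have hκ2 : κ ≤ 1 + e ^ 2 * G ^ 2 := by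
    linarith [mul_le_mul_of_nonneg_left hSG (sq_nonneg e)]
  refine ⟨k, k * e / 2, fun y => ∑ i, ((y i : ℝ) - k * (M i + e * v i)) ^ 2 ≤ (k * e / 2) ^ 2,
    by positivity, by nlinarith, fun y hy => ?_, (ENNReal.ofReal_le_ofReal (h8 κ hκ1 hκ2)).trans ?_⟩
  · have habs : ∀ i, |(y i : ℝ) - k * (M i + e * v i)| ≤ k * e / 2 := fun i =>
      abs_le_of_sq_le_sq (le_trans (Finset.single_le_sum
        (f := fun i => ((y i : ℝ) - k * (M i + e * v i)) ^ 2) (fun _ _ => sq_nonneg _)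
        (Finset.mem_univ i)) hy) (by positivity)
    refine ⟨fun i hi => ?_, ?_⟩
    · have := (abs_le.mp (habs i)).1
      rw [hMΛ i hi, hvΛ i hi] at this
      linarith
    · calc ∑ i, |(y i : ℝ) - k * M i| ≤ ∑ i, (k * e * (1 + |v i|)) := by
            refine Finset.sum_le_sum fun i _ => ?_
            have h1 : (y i : ℝ) - k * M i
              = ((y i : ℝ) - k * (M i + e * v i)) + k * e * v i := by ring
            have h2 : |k * e * v i| = k * e * |v i| := by
              rw [abs_mul, abs_of_pos (by positivity)]
            rw [h1]
            have := abs_add_le ((y i : ℝ) - k * (M i + e * v i)) (k * e * v i)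
            have hke : 0 < k * e := by positivity
            linarith [habs i]
        _ = k * (e * W) := by
            rw [← Finset.mul_sum, Finset.sum_add_distrib]; simp [hW]; ring
        _ ≤ η * k := by nlinarith
  · have hcheb := one_le_stepAvg_add hν0 hν1 hνa (fun i => (hνs i).hasSum) hνQ
      (fun i => k * (M i + e * v i)) (r := (k * e / 2) ^ 2) (by positivity) k 0
    have hhalf : (∑ i : Fin d, ((((0 : Fin d → ℤ) i : ℤ) : ℝ) + k * (M i + e * v i)
        - k * (M i + e * v i)) ^ 2 + k * Q) / (k * e / 2) ^ 2 ≤ 1 / 2 := by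
      rw [div_le_iff₀ (by positivity)]
      simp only [Pi.zero_apply, Int.cast_zero, zero_add, sub_self, ne_eq, OfNat.ofNat_ne_zero,
        not_false_eq_true, zero_pow, Finset.sum_const_zero]
      nlinarith
    have h2 := two_mul_stepAvg_le (μ := μ) hnn (fun z => by linarith [hℓ z]) hκ
      (fun y => ∑ i, ((y i : ℝ) - k * (M i + e * v i)) ^ 2 ≤ (k * e / 2) ^ 2) k
      (2 * κ ^ k)⁻¹ (by positivity) 0
    rw [inv_inv, show (2 * κ ^ k)⁻¹ * κ ^ k = 1 / 2 by field_simp] at h2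
    exact ofReal_inv_le_of_half_le hκk0
      (hcheb.trans (add_le_add le_rfl (ENNReal.ofReal_le_ofReal hhalf))) h2

/-- A superharmonic function at a point far from the boundary dominates, up to a small exponential
loss, a lower bound of it on the points that can be reached by the tilted walk. -/
lemma exists_block (hnn : ∀ z, 0 ≤ μ z) (hsum : HasSum μ 1) (hirr : Irred μ (posDom Λ))
    {M : Fin d → ℝ} (hM : ∀ i, HasSum (fun z => μ z * (z i : ℝ)) (M i)) (hMΛ : ∀ i ∈ Λ, M i = 0)
    (hsq : ∀ i, Summable fun z => μ z * (z i : ℝ) ^ 2) {η : ℝ} (hη : 0 < η) :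
    ∃ (k : ℕ) (g : ℝ) (B : ℤ), 0 < g ∧ g ≤ k ∧ ∀ u : (Fin d → ℤ) → ENNReal,
      (∀ x ∈ posDom Λ, ∑' z, emass μ z * u (x + z) ≤ u x) → ∀ x : Fin d → ℤ,
      (∀ i ∈ Λ, B ≤ x i) → ∀ t : ENNReal,
      (∀ v : Fin d → ℤ, (∀ i ∈ Λ, g ≤ v i) → ∑ i, |(v i : ℝ) - k * M i| ≤ η * k → t ≤ u (x + v)) →
      ENNReal.ofReal (Real.exp (-(η * g))) * t ≤ u x := by
  obtain ⟨k, g, p, hg, hgk, hp, hI⟩ := exists_event_prob hnn hsum hirr hM hMΛ hsq hη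
  obtain ⟨s, hs⟩ : ∃ s : Finset (Fin d → ℤ), ∑' z, (if z ∈ s then 0 else emass μ z)
      ≤ ENNReal.ofReal (Real.exp (-(η * g)) / k) := by
    have h := ENNReal.tendsto_tsum_compl_atTop_zero (f := emass μ)
      (by rw [tsum_emass hnn hsum]; simp)
    have hpos : 0 < ENNReal.ofReal (Real.exp (-(η * g)) / k) :=
      ENNReal.ofReal_pos.mpr (div_pos (Real.exp_pos _) (hg.trans_le hgk))
    obtain ⟨s, hs⟩ := (h.eventually_le_const hpos).exists
    refine ⟨s, le_trans (le_of_eq ?_) hs⟩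
    have h2 := tsum_subtype {z | z ∉ s} (emass μ)
    refine Eq.trans (tsum_congr fun z => ?_) h2.symm
    simp only [Set.indicator_apply, Set.mem_ofPred_eq]
    split_ifs <;> simp_all
  have htrunc := stepAvg_le_truncated (m := emass μ) (h := fun y => if p y then 1 else 0)
    (tsum_emass hnn hsum).le (fun y => by split_ifs <;> simp) s hs k 0
  have hmul : (k : ENNReal) * ENNReal.ofReal (Real.exp (-(η * g)) / k)
      = ENNReal.ofReal (Real.exp (-(η * g))) := by
    rw [← ENNReal.ofReal_natCast, ← ENNReal.ofReal_mul (by positivity),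
      mul_div_cancel₀ _ (hg.trans_le hgk).ne']
  have hlow := hI.trans htrunc
  rw [hmul, two_mul, ENNReal.ofReal_add (by positivity) (by positivity),
    ENNReal.add_le_add_iff_right ENNReal.ofReal_ne_top] at hlow
  obtain ⟨b, hb⟩ : ∃ b : ℤ, ∀ z ∈ s, ∀ i, |z i| ≤ b := by
    obtain ⟨b, hb⟩ := (s.image fun z => ∑ i, |z i|).bddAbove
    exact ⟨b, fun z hz i => (Finset.single_le_sum (f := fun i => |z i|)
      (fun _ _ => abs_nonneg _) (Finset.mem_univ i)).trans
      (hb (Finset.mem_coe.mpr (Finset.mem_image_of_mem _ hz)))⟩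
  refine ⟨k, g, k * b + 1, hg, hgk, fun u hu x hx t ht => ?_⟩
  have := stepAvg_truncated_le s hb hu (h := fun y => if p y then 1 else 0) (t := t) (x := x)
    (fun v => ?_) k 0 (fun i hi => ?_)
  · rw [add_zero] at this
    refine le_trans ?_ this
    rw [mul_comm]
    gcongr
  · split_ifs with hv
    · rw [mul_one]; exact ht v (hp v hv).1 (hp v hv).2
    · simp
  · have := hx i hi
    simp only [add_zero]; linarith

/-- Iterated form of the lower bound for superharmonic functions. -/
lemma exists_block_iterate (hnn : ∀ z, 0 ≤ μ z) (hsum : HasSum μ 1) (hirr : Irred μ (posDom Λ))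
    {M : Fin d → ℝ} (hM : ∀ i, HasSum (fun z => μ z * (z i : ℝ)) (M i)) (hMΛ : ∀ i ∈ Λ, M i = 0)
    (hsq : ∀ i, Summable fun z => μ z * (z i : ℝ) ^ 2) {η : ℝ} (hη : 0 < η) :
    ∃ (k : ℕ) (g : ℝ) (B : ℤ), 0 < g ∧ g ≤ k ∧ ∀ u : (Fin d → ℤ) → ENNReal,
      (∀ x ∈ posDom Λ, ∑' z, emass μ z * u (x + z) ≤ u x) → ∀ x : Fin d → ℤ,
      (∀ i ∈ Λ, B ≤ x i) → ∀ (t : ENNReal) (m : ℕ),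
      (∀ v : Fin d → ℤ, (∀ i ∈ Λ, m * g ≤ v i) →
        ∑ i, |(v i : ℝ) - m * k * M i| ≤ m * k * η → t ≤ u (x + v)) →
      ENNReal.ofReal (Real.exp (-(η * g * m))) * t ≤ u x := by
  obtain ⟨k, g, B, hg, hgk, hblock⟩ := exists_block hnn hsum hirr hM hMΛ hsq hη
  refine ⟨k, g, B, hg, hgk, fun u hu x hx t m ht => ?_⟩
  induction m generalizing x with
  | zero => simpa using ht 0 (by simp) (by simp)
  | succ m ih =>
    have h1 := hblock u hu x hx (ENNReal.ofReal (Real.exp (-(η * g * m))) * t)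
      fun v hv1 hv2 => ih (x + v) (fun i hi => ?_) fun w hw1 hw2 => ?_
    · rw [← mul_assoc, ← ENNReal.ofReal_mul (by positivity), ← Real.exp_add] at h1
      convert h1 using 4
      push_cast; ring
    · have h2 : (0 : ℝ) ≤ v i := hg.le.trans (hv1 i hi)
      have h3 : 0 ≤ v i := by exact_mod_cast h2
      have := hx i hi
      simp only [Pi.add_apply]; linarith
    · rw [add_assoc]
      refine ht (v + w) (fun i hi => ?_) ?_
      · have h2 := hv1 i hi
        have h3 := hw1 i hi
        simp only [Pi.add_apply]; push_cast; linarith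
      · calc ∑ i, |(((v + w) i : ℤ) : ℝ) - (m + 1 : ℕ) * k * M i|
            ≤ ∑ i, (|(v i : ℝ) - k * M i| + |(w i : ℝ) - m * k * M i|) := by
              refine Finset.sum_le_sum fun i _ => ?_
              refine le_trans (le_of_eq ?_) (abs_add_le _ _)
              congr 1
              simp only [Pi.add_apply]; push_cast; ring
          _ ≤ _ := by
              rw [Finset.sum_add_distrib]
              push_cast
              linarith

lemma ofReal_exp_neg_mul_le {f g : ENNReal} {a : ℝ} (h : f ≤ ENNReal.ofReal (Real.exp a) * g) :
    ENNReal.ofReal (Real.exp (-a)) * f ≤ g := by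
  calc ENNReal.ofReal (Real.exp (-a)) * f
      ≤ ENNReal.ofReal (Real.exp (-a)) * (ENNReal.ofReal (Real.exp a) * g) := by gcongr
    _ = g := by
      rw [← mul_assoc, ← ENNReal.ofReal_mul (Real.exp_pos _).le, ← Real.exp_add]; simp

lemma ofReal_exp_mul_ofReal_exp (a b : ℝ) :
    ENNReal.ofReal (Real.exp a) * ENNReal.ofReal (Real.exp b)
      = ENNReal.ofReal (Real.exp (a + b)) := by
  rw [← ENNReal.ofReal_mul (Real.exp_pos _).le, Real.exp_add]

/-- The Green function decays subexponentially in the direction of the drift. -/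
lemma eventually_le_egreen (hnn : ∀ z, 0 ≤ μ z) (hsum : HasSum μ 1) (hirr : Irred μ (posDom Λ))
    {M : Fin d → ℝ} (hM : ∀ i, HasSum (fun z => μ z * (z i : ℝ)) (M i)) (hMΛ : ∀ i ∈ Λ, M i = 0)
    (hsq : ∀ i, Summable fun z => μ z * (z i : ℝ) ^ 2) (hM0 : 0 < rnorm M)
    {xs : ℕ → Fin d → ℤ} (hxs : ∀ n, xs n ∈ posDom Λ)
    (hnorm : Tendsto (fun n => znorm (xs n)) atTop atTop)
    (hdir : Tendsto (fun n i => (xs n i : ℝ) / znorm (xs n)) atTop (𝓝 fun i => M i / rnorm M))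
    {x₀ : Fin d → ℤ} (hx₀ : x₀ ∈ posDom Λ) {κ : ℝ} (hκ : 0 < κ) :
    ∀ᶠ n in atTop, ENNReal.ofReal (Real.exp (-(κ * znorm (xs n))))
      ≤ egreen μ (posDom Λ) x₀ (xs n) := by
  obtain ⟨K, hK, hH⟩ := exists_egreen_harnack hnn hsum hirr
  set R := rnorm M with hR
  set E : ℝ := 1 / R + K * (1 + 1 / R) with hE
  have hE0 : 0 < E := by positivity
  set η : ℝ := κ / (2 * E) with hηdef
  have hη : 0 < η := by positivity
  obtain ⟨k, g, B, hg, hgk, hblock⟩ := exists_block_iterate hnn hsum hirr hM hMΛ hsq hη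
  have hk : (0 : ℝ) < k := hg.trans_le hgk
  set x₁ : Fin d → ℤ := fun i => x₀ i + |B| with hx₁def
  have hx₁B : ∀ i ∈ Λ, B ≤ x₁ i := fun i hi => by
    have := hx₀ i hi
    have := le_abs_self B
    simp only [hx₁def]; linarith
  have hx₁ : x₁ ∈ posDom Λ := fun i hi => by
    have := hx₀ i hi
    have := abs_nonneg B
    simp only [hx₁def]; linarith
  set D : ℝ := K * znorm (x₀ - x₁) + K * (znorm x₁ + k * R) with hD
  have hdist : ∀ᶠ n in atTop, ∑ i, |(xs n i : ℝ) / znorm (xs n) - M i / R| ≤ η := by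
    have h1 : Tendsto (fun n => ∑ i, |(xs n i : ℝ) / znorm (xs n) - M i / R|) atTop (𝓝 0) := by
      have h2 : Tendsto (fun n => ∑ i, |(xs n i : ℝ) / znorm (xs n) - M i / R|) atTop
          (𝓝 (∑ i, |M i / R - M i / R|)) :=
        tendsto_finsetSum _ fun i _ => ((tendsto_pi_nhds.mp hdir i).sub_const _).abs
      simpa using h2
    exact h1.eventually_le_const hη
  filter_upwards [hdist, hnorm.eventually_ge_atTop 1,
    hnorm.eventually_ge_atTop (2 * D / κ)] with n hn hY1 hYD
  set y := xs n with hy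
  set Y := znorm y with hYdef
  have hY0 : 0 < Y := one_pos.trans_le hY1
  set m : ℕ := ⌊Y / (k * R)⌋₊ with hm
  have hm1 : m * (k * R) ≤ Y := (le_div_iff₀ (by positivity)).mp (Nat.floor_le (by positivity))
  have hm2 : Y < (m + 1) * (k * R) := (div_lt_iff₀ (by positivity)).mp (Nat.lt_floor_add_one _)
  have hmk : m * k ≤ Y / R := by rw [le_div_iff₀ hM0]; linarith
  have hmk2 : Y / R < m * k + k := by rw [div_lt_iff₀ hM0]; linarith
  have hn' : ∑ i, |(y i : ℝ) - Y / R * M i| ≤ η * Y := by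
    calc ∑ i, |(y i : ℝ) - Y / R * M i| = ∑ i, |(y i : ℝ) / Y - M i / R| * Y := by
          refine Finset.sum_congr rfl fun i _ => ?_
          rw [← abs_of_pos hY0, ← abs_mul, abs_of_pos hY0]
          congr 1; field_simp
      _ ≤ _ := by rw [← Finset.sum_mul]; gcongr
  have hpt : ∀ v : Fin d → ℤ, (∀ i ∈ Λ, m * g ≤ v i) →
      ∑ i, |(v i : ℝ) - m * k * M i| ≤ m * k * η →
      ENNReal.ofReal (Real.exp (-(K * (znorm x₁ + k * R + η * Y * (1 + 1 / R)))))
        ≤ egreen μ (posDom Λ) (x₁ + v) y := by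
    intro v hv1 hv2
    have hv : x₁ + v ∈ posDom Λ := fun i hi => by
      have h2 : (0 : ℝ) ≤ v i := le_trans (by positivity) (hv1 i hi)
      have h3 : 0 ≤ v i := by exact_mod_cast h2
      have := hx₁ i hi
      simp only [Pi.add_apply]; linarith
    have h1 := ofReal_exp_neg_mul_le (hH y (hxs n) _ hv y)
    refine le_trans ?_ h1
    refine le_trans ?_ (mul_le_mul_right (one_le_egreen_self (hxs n)) _)
    rw [mul_one]
    refine ENNReal.ofReal_le_ofReal (Real.exp_le_exp.mpr (neg_le_neg ?_))
    gcongr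
    have h3 : znorm (v - y) ≤ k * R + η * Y * (1 + 1 / R) := by
      calc znorm (v - y) ≤ ∑ i, (|(v i : ℝ) - m * k * M i| + (Y / R - m * k) * |M i|
            + |(y i : ℝ) - Y / R * M i|) := by
            refine Finset.sum_le_sum fun i _ => ?_
            have e1 : (((v - y) i : ℤ) : ℝ) = ((v i : ℝ) - m * k * M i)
                - (Y / R - m * k) * M i - ((y i : ℝ) - Y / R * M i) := by
              simp only [Pi.sub_apply]; push_cast; ring
            have e2 : |(Y / R - m * k) * M i| = (Y / R - m * k) * |M i| := by
              rw [abs_mul, abs_of_nonneg (by linarith)]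
            rw [e1, ← e2]
            exact (abs_sub _ _).trans (add_le_add (abs_sub _ _) le_rfl)
        _ = ∑ i, |(v i : ℝ) - m * k * M i| + (Y / R - m * k) * R
            + ∑ i, |(y i : ℝ) - Y / R * M i| := by
            rw [Finset.sum_add_distrib, Finset.sum_add_distrib, ← Finset.mul_sum]; rfl
        _ ≤ Y / R * η + k * R + η * Y := by
            have := mul_le_mul_of_nonneg_right hmk hη.le
            have := mul_le_mul_of_nonneg_right (show Y / R - m * k ≤ k by linarith) hM0.le
            linarith
        _ = _ := by ring
    have h4 := znorm_add_le x₁ (v - y)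
    rw [← add_sub_assoc] at h4
    linarith
  have h1 := hblock (fun x => egreen μ (posDom Λ) x y)
    (fun x hx => tsum_emass_mul_egreen_le hnn hsum hx y) x₁ hx₁B _ m hpt
  have h2 := ofReal_exp_neg_mul_le (hH x₁ hx₁ x₀ hx₀ y)
  refine le_trans ?_ ((mul_le_mul_right h1 _).trans h2)
  rw [ofReal_exp_mul_ofReal_exp, ofReal_exp_mul_ofReal_exp]
  refine ENNReal.ofReal_le_ofReal (Real.exp_le_exp.mpr ?_)
  have h3 : D ≤ κ * Y / 2 := by
    rw [div_le_iff₀ hκ] at hYD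
    linarith
  have h4 : η * g * m ≤ η * (Y / R) := by
    rw [mul_assoc]
    gcongr
    refine le_trans ?_ hmk
    rw [mul_comm]
    gcongr
  have h5 : η * (Y / R) + K * (η * Y * (1 + 1 / R)) = κ * Y / 2 := by
    calc _ = η * E * Y := by rw [hE]; ring
      _ = _ := by rw [hηdef]; field_simp
  rw [hD] at h3
  linarith

/-- Near the origin, the Green function is almost monotone along every unit step that does not
decrease the constrained coordinates. -/
lemma exists_egreen_le_add_unitStep (hnn : ∀ z, 0 ≤ μ z) (hsum : HasSum μ 1)
    (hirr : Irred μ (posDom Λ)) {s b : ℝ} (hs : 0 < s) (hb : 0 ≤ b)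
    (hm : ∑' z, emass μ z * ENNReal.ofReal (Real.exp (s * znorm z)) ≤ ENNReal.ofReal (Real.exp b))
    {xs : ℕ → Fin d → ℤ} (hnorm : Tendsto (fun n => znorm (xs n)) atTop atTop)
    {x₀ : Fin d → ℤ} (hx₀ : x₀ ∈ posDom Λ)
    (hlow : ∀ κ : ℝ, 0 < κ → ∀ᶠ n in atTop, ENNReal.ofReal (Real.exp (-(κ * znorm (xs n))))
      ≤ egreen μ (posDom Λ) x₀ (xs n)) {ε : ℝ} (hε : 0 < ε) (hε1 : ε ≤ 1)
    {w : Fin d → ℤ} (hw : w ∈ unitSteps d) (hwΛ : ∀ i ∈ Λ, 0 ≤ w i) :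
    ∃ δ : ℝ, 0 < δ ∧ ∀ᶠ n in atTop, ∀ z ∈ posDom Λ, znorm z ≤ δ * znorm (xs n) →
      egreen μ (posDom Λ) z (xs n)
        ≤ ENNReal.ofReal (Real.exp ε) * egreen μ (posDom Λ) (z + w) (xs n) := by
  obtain ⟨K, hK, hH⟩ := exists_egreen_harnack hnn hsum hirr
  have hw1 := znorm_unitSteps hw
  have hw0 : w ≠ 0 := by rintro rfl; simp [znorm] at hw1
  have hadd : ∀ x ∈ posDom Λ, x + w ∈ posDom Λ := fun x hx i hi =>
    add_pos_of_pos_of_nonneg (hx i hi) (hwΛ i hi)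
  obtain ⟨k, p, hk, hp0, hp1, hp⟩ := exists_pattern (b := fun _ => 1) hnn hsum hirr
    (fun _ _ => one_pos) (hadd _ fun _ _ => one_pos)
  obtain ⟨c, C, hc, hC, hcomp⟩ := egreen_shift_compare hnn hsum hs hb hm hadd (hk hw0) hp0 hp1
    (fun x hx => hp x hx) (ε := ε / 4) (by positivity) (by linarith)
  have hexp : ∀ᶠ n in atTop,
      C * Real.exp (K * (1 + znorm x₀)) / (ε / 4) ≤ Real.exp (c / 4 * znorm (xs n)) :=
    (Real.tendsto_exp_atTop.comp
      (hnorm.const_mul_atTop (by positivity : 0 < c / 4))).eventually_ge_atTop _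
  refine ⟨min (1 / 2) (c / (8 * K)), by positivity, ?_⟩
  filter_upwards [hexp, hlow (c / 8) (by positivity), hnorm.eventually_ge_atTop 0]
    with n hn hl hY0 z hz hzn
  set y := xs n with hy
  set Y := znorm y with hYdef
  have hz1 : znorm z ≤ Y / 2 := hzn.trans (by
    have := mul_le_mul_of_nonneg_right (min_le_left (1 / 2 : ℝ) (c / (8 * K))) hY0
    linarith)
  have hz2 : K * znorm z ≤ c / 8 * Y := by
    have h1 := mul_le_mul_of_nonneg_left (hzn.trans
      (mul_le_mul_of_nonneg_right (min_le_right (1 / 2 : ℝ) (c / (8 * K))) hY0)) hK.le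
    calc _ ≤ _ := h1
      _ = _ := by field_simp
  have herr : ENNReal.ofReal (C * Real.exp (-(c * znorm (y - z))))
      ≤ ENNReal.ofReal (ε / 4) * egreen μ (posDom Λ) (z + w) y := by
    have h1 := ofReal_exp_neg_mul_le (hH x₀ hx₀ _ (hadd z hz) y)
    refine le_trans ?_ (mul_le_mul_right ((mul_le_mul_right hl _).trans h1) _)
    rw [ofReal_exp_mul_ofReal_exp, ← ENNReal.ofReal_mul (by positivity)]
    refine ENNReal.ofReal_le_ofReal ?_
    have h2 : znorm (z + w - x₀) ≤ znorm z + 1 + znorm x₀ := by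
      have := znorm_sub_le (z + w) x₀
      have := znorm_add_le z w
      linarith
    have h3 : Y ≤ znorm (y - z) + znorm z := by
      have := znorm_add_le (y - z) z
      rwa [sub_add_cancel] at this
    rw [div_le_iff₀ (by positivity)] at hn
    calc C * Real.exp (-(c * znorm (y - z))) ≤ C * Real.exp (-(c * (Y / 2))) := by
          gcongr; linarith
      _ = C * Real.exp (K * (1 + znorm x₀))
          * Real.exp (-(c * (Y / 2)) - K * (1 + znorm x₀)) := by
          rw [mul_assoc, ← Real.exp_add]; congr 2; ring
      _ ≤ Real.exp (c / 4 * Y) * (ε / 4)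
          * Real.exp (-(c * (Y / 2)) - K * (1 + znorm x₀)) := by gcongr
      _ = ε / 4 * Real.exp (-(c / 4 * Y) - K * (1 + znorm x₀)) := by
          rw [mul_comm (Real.exp _), mul_assoc, ← Real.exp_add]; congr 2; ring
      _ ≤ _ := by
          gcongr
          have := mul_le_mul_of_nonneg_left h2 hK.le
          linarith
  have hmain := (hcomp z y).trans (add_le_add le_rfl herr)
  calc egreen μ (posDom Λ) z y
      = ENNReal.ofReal (1 - ε / 4)⁻¹
          * (ENNReal.ofReal (1 - ε / 4) * egreen μ (posDom Λ) z y) := by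
        rw [← mul_assoc, ← ENNReal.ofReal_mul (inv_nonneg.mpr (by linarith)),
          inv_mul_cancel₀ (by linarith), ENNReal.ofReal_one, one_mul]
    _ ≤ ENNReal.ofReal (1 - ε / 4)⁻¹
          * (ENNReal.ofReal (1 + ε / 4) * egreen μ (posDom Λ) (z + w) y) := by
        refine mul_le_mul_right ?_ _
        rwa [ENNReal.ofReal_add zero_le_one (by positivity), ENNReal.ofReal_one, add_mul, one_mul]
    _ ≤ _ := by
        rw [← mul_assoc, ← ENNReal.ofReal_mul (inv_nonneg.mpr (by linarith))]
        gcongr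
        refine le_trans ?_ (Real.add_one_le_exp ε)
        rw [inv_mul_le_iff₀ (by linarith)]
        nlinarith

/-- Near the origin, the Green function is almost monotone in the constrained coordinates. -/
lemma exists_egreen_le_of_le (hnn : ∀ z, 0 ≤ μ z) (hsum : HasSum μ 1)
    (hirr : Irred μ (posDom Λ)) {s b : ℝ} (hs : 0 < s) (hb : 0 ≤ b)
    (hm : ∑' z, emass μ z * ENNReal.ofReal (Real.exp (s * znorm z)) ≤ ENNReal.ofReal (Real.exp b))
    {xs : ℕ → Fin d → ℤ} (hnorm : Tendsto (fun n => znorm (xs n)) atTop atTop)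
    {x₀ : Fin d → ℤ} (hx₀ : x₀ ∈ posDom Λ)
    (hlow : ∀ κ : ℝ, 0 < κ → ∀ᶠ n in atTop, ENNReal.ofReal (Real.exp (-(κ * znorm (xs n))))
      ≤ egreen μ (posDom Λ) x₀ (xs n)) {ε : ℝ} (hε : 0 < ε) (hε1 : ε ≤ 1) :
    ∃ δ : ℝ, 0 < δ ∧ ∀ᶠ n in atTop, ∀ x ∈ posDom Λ, ∀ x' ∈ posDom Λ, (∀ i ∈ Λ, x i ≤ x' i) →
      znorm x + znorm x' ≤ δ * znorm (xs n) → egreen μ (posDom Λ) x (xs n)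
        ≤ ENNReal.ofReal (Real.exp (ε * znorm (x' - x))) * egreen μ (posDom Λ) x' (xs n) := by
  have hstep : ∃ δ : ℝ, 0 < δ ∧ ∀ w ∈ unitSteps d, ∀ᶠ n in atTop, (∀ i ∈ Λ, 0 ≤ w i) →
      ∀ z ∈ posDom Λ, znorm z ≤ δ * znorm (xs n) → egreen μ (posDom Λ) z (xs n)
        ≤ ENNReal.ofReal (Real.exp ε) * egreen μ (posDom Λ) (z + w) (xs n) := by
    have h1 : ∀ w ∈ unitSteps d, ∀ᶠ δ in 𝓝[>] (0 : ℝ), ∀ᶠ n in atTop, (∀ i ∈ Λ, 0 ≤ w i) →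
        ∀ z ∈ posDom Λ, znorm z ≤ δ * znorm (xs n) → egreen μ (posDom Λ) z (xs n)
          ≤ ENNReal.ofReal (Real.exp ε) * egreen μ (posDom Λ) (z + w) (xs n) := by
      intro w hw
      by_cases hwΛ : ∀ i ∈ Λ, 0 ≤ w i
      · obtain ⟨δ, hδ, h⟩ := exists_egreen_le_add_unitStep hnn hsum hirr hs hb hm hnorm hx₀ hlow
          hε hε1 hw hwΛ
        filter_upwards [Ioo_mem_nhdsGT hδ] with δ' hδ'
        filter_upwards [h] with n hn _ z hz hzn
        refine hn z hz (hzn.trans ?_)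
        exact mul_le_mul_of_nonneg_right hδ'.2.le (znorm_nonneg _)
      · exact .of_forall fun _ => .of_forall fun _ h => absurd h hwΛ
    obtain ⟨δ, hδ, hδ0⟩ := (((eventually_all_finite finite_unitSteps).mpr h1).and
      self_mem_nhdsWithin).exists
    exact ⟨δ, hδ0, hδ⟩
  obtain ⟨δ, hδ, h⟩ := hstep
  refine ⟨δ, hδ, ?_⟩
  filter_upwards [(eventually_all_finite finite_unitSteps).mpr h] with n hn x hx x' hx' hle hxn
  refine le_of_unitSteps (fun z => egreen μ (posDom Λ) z (xs n)) ε
    {z | ∀ i, min (x i) (x' i) ≤ z i ∧ z i ≤ max (x i) (x' i)} x' ?_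
    (fun i => ⟨min_le_left _ _, le_max_left _ _⟩)
  intro z hz w hw hzw
  refine ⟨fun i => ?_, hn w hw (fun i hi => ?_) z (fun i hi => ?_) (le_trans ?_ hxn)⟩
  · have h1 := hz i
    have h2 := hzw i
    grind
  · have h1 := hz i
    have h2 := hzw i
    have h3 := hle i hi
    simp only [Pi.add_apply] at h2
    grind
  · exact (lt_min (hx i hi) (hx' i hi)).trans_le (hz i).1
  · unfold znorm
    rw [← Finset.sum_add_distrib]
    refine Finset.sum_le_sum fun i _ => ?_
    have h1 := hz i
    have h2 : |z i| ≤ |x i| + |x' i| := abs_le.mpr <| by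
      have h3 := neg_abs_le (x i)
      have h4 := neg_abs_le (x' i)
      have h5 := le_abs_self (x i)
      have h6 := le_abs_self (x' i)
      omega
    exact_mod_cast h2

/-- Ratios of Green functions in the direction of the drift grow subexponentially. -/
lemma exists_egreen_le_exp (hnn : ∀ z, 0 ≤ μ z) (hsum : HasSum μ 1) (hirr : Irred μ (posDom Λ))
    {s b : ℝ} (hs : 0 < s) (hb : 0 ≤ b)
    (hm : ∑' z, emass μ z * ENNReal.ofReal (Real.exp (s * znorm z)) ≤ ENNReal.ofReal (Real.exp b))
    {M : Fin d → ℝ} (hM : ∀ i, HasSum (fun z => μ z * (z i : ℝ)) (M i)) (hMΛ : ∀ i ∈ Λ, M i = 0)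
    (hM0 : 0 < rnorm M) {xs : ℕ → Fin d → ℤ} (hxs : ∀ n, xs n ∈ posDom Λ)
    (hnorm : Tendsto (fun n => znorm (xs n)) atTop atTop)
    (hdir : Tendsto (fun n i => (xs n i : ℝ) / znorm (xs n)) atTop (𝓝 fun i => M i / rnorm M))
    {x₀ : Fin d → ℤ} (hx₀ : x₀ ∈ posDom Λ) {ε : ℝ} (hε : 0 < ε) :
    ∃ δ D : ℝ, 0 < δ ∧ ∀ᶠ n in atTop, ∀ x ∈ posDom Λ, znorm x ≤ δ * znorm (xs n) →
      egreen μ (posDom Λ) x (xs n)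
        ≤ ENNReal.ofReal (Real.exp (D + ε * znorm x)) * egreen μ (posDom Λ) x₀ (xs n) := by
  have hsq := summable_mul_sq hnn hs hm
  obtain ⟨K, hK, hH⟩ := exists_egreen_harnack hnn hsum hirr
  set η : ℝ := ε / 2 with hη
  have hη0 : 0 < η := by positivity
  obtain ⟨k, g, B, hg, hgk, hblock⟩ := exists_block_iterate hnn hsum hirr hM hMΛ hsq hη0
  set x₁ : Fin d → ℤ := fun i => x₀ i + |B| with hx₁def
  have hx₁B : ∀ i ∈ Λ, B ≤ x₁ i := fun i hi => by
    have := hx₀ i hi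
    have := le_abs_self B
    simp only [hx₁def]; linarith
  have hx₁ : x₁ ∈ posDom Λ := fun i hi => by
    have := hx₀ i hi
    have := abs_nonneg B
    simp only [hx₁def]; linarith
  set K₁ : ℝ := 1 + k * (η + rnorm M) / g with hK₁
  set K₂ : ℝ := znorm x₁ + k * (η + rnorm M) with hK₂
  have hK₁0 : 0 < K₁ := by positivity
  have hK₂0 : 0 ≤ K₂ := add_nonneg (znorm_nonneg _) (by positivity)
  set ε' : ℝ := min 1 (ε / (2 * K₁)) with hε'
  have hε'0 : 0 < ε' := by positivity
  have hε'K : ε' * K₁ ≤ ε / 2 := by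
    calc ε' * K₁ ≤ ε / (2 * K₁) * K₁ := by gcongr; exact min_le_right _ _
      _ = ε / 2 := by field_simp
  obtain ⟨δ, hδ, hmono⟩ := exists_egreen_le_of_le hnn hsum hirr hs hb hm hnorm hx₀
    (fun κ hκ => eventually_le_egreen hnn hsum hirr hM hMΛ hsq hM0 hxs hnorm hdir hx₀ hκ)
    hε'0 (min_le_left _ _)
  refine ⟨δ / (2 * K₁), η * g + ε' * K₂ + K * znorm (x₀ - x₁), by positivity, ?_⟩
  filter_upwards [hmono, hnorm.eventually_ge_atTop (2 * K₂ / δ)] with n hn hY x hx hxn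
  set y := xs n with hy
  set r := znorm x with hr
  have hr0 : 0 ≤ r := znorm_nonneg x
  have hbound : K₁ * r + K₂ ≤ δ * znorm y := by
    rw [div_le_iff₀ hδ] at hY
    have h1 := mul_le_mul_of_nonneg_left hxn hK₁0.le
    have h2 : K₁ * (δ / (2 * K₁) * znorm y) = δ * znorm y / 2 := by field_simp
    linarith
  set m : ℕ := ⌈r / g⌉₊ with hm
  have hm1 : r ≤ m * g := (div_le_iff₀ hg).mp (Nat.le_ceil _)
  have hm2 : m < r / g + 1 := Nat.ceil_lt_add_one (by positivity)
  have hm3 : m * g ≤ r + g := by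
    have := mul_le_mul_of_nonneg_right hm2.le hg.le
    rwa [add_mul, one_mul, div_mul_cancel₀ _ hg.ne'] at this
  have hpt : ∀ v : Fin d → ℤ, (∀ i ∈ Λ, m * g ≤ v i) →
      ∑ i, |(v i : ℝ) - m * k * M i| ≤ m * k * η →
      ENNReal.ofReal (Real.exp (-(ε' * (K₁ * r + K₂)))) * egreen μ (posDom Λ) x y
        ≤ egreen μ (posDom Λ) (x₁ + v) y := by
    intro v hv1 hv2
    have hxv : ∀ i ∈ Λ, x i ≤ (x₁ + v) i := fun i hi => by
      have h1 : |(x i : ℝ)| ≤ r := Finset.single_le_sum (f := fun i => |(x i : ℝ)|)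
        (fun _ _ => abs_nonneg _) (Finset.mem_univ i)
      have h2 : (x i : ℝ) ≤ v i := (le_abs_self _).trans (h1.trans (hm1.trans (hv1 i hi)))
      have h3 : x i ≤ v i := by exact_mod_cast h2
      have := hx₁ i hi
      simp only [Pi.add_apply]; linarith
    have hv : znorm v ≤ (r / g + 1) * (k * (η + rnorm M)) := by
      calc znorm v ≤ ∑ i, (|(v i : ℝ) - m * k * M i| + m * k * |M i|) := by
            refine Finset.sum_le_sum fun i _ => ?_
            have h1 : |m * k * M i| = m * k * |M i| := by
              rw [abs_mul, abs_of_nonneg (by positivity)]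
            rw [← h1]
            refine le_trans (le_of_eq ?_) (abs_add_le _ _)
            rw [sub_add_cancel]
        _ = ∑ i, |(v i : ℝ) - m * k * M i| + m * k * rnorm M := by
            rw [Finset.sum_add_distrib, ← Finset.mul_sum]; rfl
        _ ≤ m * (k * (η + rnorm M)) := by linarith
        _ ≤ _ := by gcongr
    have hK12 : r + (znorm x₁ + (r / g + 1) * (k * (η + rnorm M))) = K₁ * r + K₂ := by
      rw [hK₁, hK₂]; field_simp; ring
    have h1 := znorm_add_le x₁ v
    have h2 := hn x hx (x₁ + v) (fun i hi => (hx i hi).trans_le (hxv i hi)) hxv (by linarith)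
    refine ofReal_exp_neg_mul_le (h2.trans ?_)
    gcongr
    have := znorm_sub_le (x₁ + v) x
    linarith
  have h1 := hblock (fun x => egreen μ (posDom Λ) x y)
    (fun x hx => tsum_emass_mul_egreen_le hnn hsum hx y) x₁ hx₁B _ m hpt
  have h2 := (mul_le_mul_right h1 _).trans (ofReal_exp_neg_mul_le (hH x₁ hx₁ x₀ hx₀ y))
  rw [← mul_assoc, ← mul_assoc, ofReal_exp_mul_ofReal_exp, ofReal_exp_mul_ofReal_exp] at h2
  refine le_trans ?_ (mul_le_mul_right h2 _)
  rw [← mul_assoc, ofReal_exp_mul_ofReal_exp]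
  refine le_mul_of_one_le_left' ?_
  rw [ENNReal.one_le_ofReal, Real.one_le_exp_iff]
  have h3 := mul_le_mul_of_nonneg_left hm3 hη0.le
  have h4 := mul_le_mul_of_nonneg_right hε'K hr0
  rw [hη] at h3 ⊢
  linarith

end KilledWalk

theorem statement13 {d : ℕ} (μ : (Fin d → ℤ) → ℝ)
    (hnn : ∀ z, 0 ≤ μ z) (hsum : HasSum μ 1)
    (hA1 : A1 μ) (hA2 : A2 μ) (hA3 : A3 μ)
    (xs : ℕ → (Fin d → ℤ)) (hxs : ∀ n, xs n ∈ posDom (LambdaM μ))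
    (hnorm : Tendsto (fun n => znorm (xs n)) atTop atTop)
    (hdir : Tendsto (fun n i => (xs n i : ℝ) / znorm (xs n)) atTop
      (𝓝 (fun i => Mvec μ i / rnorm (Mvec μ))))
    (xhat : Fin d → ℤ) (hxhat : xhat ∈ posDom (LambdaM μ))
    (ε : ℝ) (hε : 0 < ε) :
    ∃ N : ℕ, 0 < N ∧ ∃ δ : ℝ, 0 < δ ∧ ∃ C : ℝ, 0 < C ∧
      ∀ n ≥ N, ∀ x ∈ posDom (LambdaM μ), znorm x ≤ δ * znorm (xs n) →
        green μ (posDom (LambdaM μ)) x (xs n) / green μ (posDom (LambdaM μ)) xhat (xs n)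
          ≤ C * Real.exp (ε * znorm x) := by
  obtain ⟨s, b, hs, hb, hm⟩ := exists_exp_moment hsum hnn hA2
  have hM : ∀ i, HasSum (fun z => μ z * (z i : ℝ)) (Mvec μ i) := fun i => by
    refine (Summable.of_norm_bounded (hsum.summable.add (summable_mul_sq hnn hs hm i))
      fun z => ?_).hasSum
    rw [Real.norm_eq_abs, abs_mul, abs_of_nonneg (hnn z)]
    have h1 : |(z i : ℝ)| ≤ 1 + (z i : ℝ) ^ 2 := by
      rw [← sq_abs]
      nlinarith [sq_nonneg (|(z i : ℝ)| - 1), abs_nonneg (z i : ℝ)]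
    have h2 := mul_le_mul_of_nonneg_left h1 (hnn z)
    linarith
  have hM0 : 0 < rnorm (Mvec μ) := by
    obtain ⟨i, hi⟩ := Function.ne_iff.mp hA3
    exact Finset.sum_pos' (fun _ _ => abs_nonneg _) ⟨i, Finset.mem_univ i, abs_pos.mpr hi⟩
  obtain ⟨δ, D, hδ, h⟩ := exists_egreen_le_exp hnn hsum (hA1 (LambdaM μ)) hs hb hm hM
    (fun i hi => hi) hM0 hxs hnorm hdir hxhat hε
  obtain ⟨N, hN⟩ := eventually_atTop.mp h
  refine ⟨N + 1, Nat.succ_pos N, δ, hδ, Real.exp D, Real.exp_pos D, fun n hn x hx hxn => ?_⟩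
  have hle := hN n (by omega) x hx hxn
  rw [toReal_egreen hnn hsum, toReal_egreen hnn hsum, ← Real.exp_add]
  by_cases htop : egreen μ (posDom (LambdaM μ)) xhat (xs n) = ⊤
  · rw [htop, ENNReal.toReal_top, div_zero]
    exact (Real.exp_pos _).le
  · refine div_le_of_le_mul₀ ENNReal.toReal_nonneg (Real.exp_pos _).le ?_
    refine (ENNReal.toReal_mono (ENNReal.mul_ne_top ENNReal.ofReal_ne_top htop) hle).trans_eq ?_
    rw [ENNReal.toReal_mul, ENNReal.toReal_ofReal (Real.exp_pos _).le]
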